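/- Let f = (f_1,…,f_r) ⊆ A = K[x_1,…,x_n] be an ideal generated by a homogeneous regular sequence of degree a = (a_1,…,a_r), and suppose {f_1,…,f_r} is a Gröbner basis of f with respect to some monomial order on A (equivalently, the initial ideal of f is generated by the initial monomials of f_1,…,f_r). Then every homogeneous ideal of A containing f satisfies EGH_a. -/

import Mathlib

open MvPolynomial

section Defs

variable {K : Type*} [Field K]

/-- Total degree of an exponent vector. -/
def expDeg {n : ℕ} (m : Fin n →₀ ℕ) : ℕ := ∑ i, m i

/-- `lexLe m m'` means `m ≤ m'` in the lexicographic order with `x_1 > x_2 > … > x_n`. -/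
def lexLe {n : ℕ} (m m' : Fin n →₀ ℕ) : Prop :=
  m = m' ∨ ∃ i : Fin n, (∀ j : Fin n, j < i → m j = m' j) ∧ m i < m' i

/-- A lex-segment in degree `d`: an upward (w.r.t. lex) closed set of degree-`d`
exponent vectors. -/
def IsLexSegment (n d : ℕ) (S : Set (Fin n →₀ ℕ)) : Prop :=
  (∀ m ∈ S, expDeg m = d) ∧
    ∀ m ∈ S, ∀ m' : Fin n →₀ ℕ, expDeg m' = d → lexLe m m' → m' ∈ S

/-- The pure-powers ideal `(x_1^{a_1}, …, x_r^{a_r})`. -/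
noncomputable def purePowers (K : Type*) [Field K] {n r : ℕ} (hrn : r ≤ n)
    (a : Fin r → ℕ) : Ideal (MvPolynomial (Fin n) K) :=
  Ideal.span (Set.range fun i : Fin r => X (Fin.castLE hrn i) ^ a i)

/-- A homogeneous ideal. -/
def IsHomog {n : ℕ} (I : Ideal (MvPolynomial (Fin n) K)) : Prop :=
  ∀ f ∈ I, ∀ d : ℕ, homogeneousComponent d f ∈ I

/-- The degree-`d` component of an ideal, as a `K`-subspace. -/
noncomputable def component {n : ℕ} (I : Ideal (MvPolynomial (Fin n) K)) (d : ℕ) :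
    Submodule K (MvPolynomial (Fin n) K) :=
  Submodule.restrictScalars K I ⊓ homogeneousSubmodule (Fin n) K d

/-- Hilbert function of an ideal: `dim_K I_d`. -/
noncomputable def hilb {n : ℕ} (I : Ideal (MvPolynomial (Fin n) K)) (d : ℕ) : ℕ :=
  Module.finrank K ↥(component I d)

/-- An `a`-lpp (lex-plus-powers) ideal: a homogeneous (monomial) ideal each of whose graded
components is the span of a lex-segment plus the corresponding component of the
pure-powers ideal. -/
def IsLPP {n r : ℕ} (hrn : r ≤ n) (a : Fin r → ℕ)
    (J : Ideal (MvPolynomial (Fin n) K)) : Prop :=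
  IsHomog J ∧
    ∀ d : ℕ, ∃ S : Set (Fin n →₀ ℕ), IsLexSegment n d S ∧
      component J d =
        Submodule.span K ((fun m => (monomial m (1 : K) : MvPolynomial (Fin n) K)) '' S)
          ⊔ component (purePowers K hrn a) d

/-- `I` satisfies `EGH_a(d)`. -/
def EGHd {n r : ℕ} (hrn : r ≤ n) (a : Fin r → ℕ)
    (I : Ideal (MvPolynomial (Fin n) K)) (d : ℕ) : Prop :=
  ∃ J : Ideal (MvPolynomial (Fin n) K), IsLPP hrn a J ∧
    hilb J d = hilb I d ∧ hilb J (d + 1) ≤ hilb I (d + 1)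

/-- `I` satisfies `EGH_a`. -/
def EGH {n r : ℕ} (hrn : r ≤ n) (a : Fin r → ℕ)
    (I : Ideal (MvPolynomial (Fin n) K)) : Prop :=
  ∀ d : ℕ, EGHd hrn a I d

/-- A monomial ideal. -/
def IsMonomialIdeal {n : ℕ} (I : Ideal (MvPolynomial (Fin n) K)) : Prop :=
  ∃ M : Set (Fin n →₀ ℕ),
    I = Ideal.span ((fun m => (monomial m (1 : K) : MvPolynomial (Fin n) K)) '' M)

/-- A strongly stable (monomial) ideal. -/
def IsStronglyStable {n : ℕ} (S : Ideal (MvPolynomial (Fin n) K)) : Prop :=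
  IsMonomialIdeal S ∧
    ∀ (m : Fin n →₀ ℕ) (i j : Fin n), j ≤ i →
      (monomial (m + Finsupp.single i 1) (1 : K) : MvPolynomial (Fin n) K) ∈ S →
      (monomial (m + Finsupp.single j 1) (1 : K) : MvPolynomial (Fin n) K) ∈ S

/-- An `a`-spp (strongly-stable-plus-powers) ideal. -/
def IsSPP {n r : ℕ} (hrn : r ≤ n) (a : Fin r → ℕ)
    (J : Ideal (MvPolynomial (Fin n) K)) : Prop :=
  ∃ S : Ideal (MvPolynomial (Fin n) K), IsStronglyStable S ∧ J = S ⊔ purePowers K hrn a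

/-- A regular sequence: each `f i` is a non-zerodivisor modulo `(f j : j < i)`. -/
def IsRegSeq {n r : ℕ} (f : Fin r → MvPolynomial (Fin n) K) : Prop :=
  ∀ i : Fin r, ∀ g : MvPolynomial (Fin n) K,
    g * f i ∈ Ideal.span { p | ∃ j : Fin r, j < i ∧ p = f j } →
    g ∈ Ideal.span { p | ∃ j : Fin r, j < i ∧ p = f j }

/-- `I` contains a homogeneous regular sequence of degree `a`. -/
def ContainsRegSeq {n r : ℕ} (a : Fin r → ℕ)
    (I : Ideal (MvPolynomial (Fin n) K)) : Prop :=
  ∃ f : Fin r → MvPolynomial (Fin n) K,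
    (∀ i, f i ∈ I) ∧ IsRegSeq f ∧ ∀ i, (f i).IsHomogeneous (a i)

/-- `dim_K (N/P)` for ideals `P ≤ N` (the `K`-dimension of `N/(N ∩ P)`). -/
noncomputable def quotDim (K : Type*) [Field K] {n : ℕ}
    (N P : Ideal (MvPolynomial (Fin n) K)) : ℕ :=
  Module.finrank K
    (↥(Submodule.restrictScalars K N) ⧸
      Submodule.comap (Submodule.restrictScalars K N).subtype (Submodule.restrictScalars K P))

/-- `dim_K (I/F)_d`. -/
noncomputable def relHilb {n : ℕ} (I F : Ideal (MvPolynomial (Fin n) K)) (d : ℕ) : ℕ :=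
  Module.finrank K
    (↥(component I d) ⧸ Submodule.comap (component I d).subtype (Submodule.restrictScalars K F))

/-- `dim_K (A/I)_d`. -/
noncomputable def hilbQ {n : ℕ} (I : Ideal (MvPolynomial (Fin n) K)) (d : ℕ) : ℕ :=
  Module.finrank K
    (↥(homogeneousSubmodule (Fin n) K d) ⧸
      Submodule.comap (homogeneousSubmodule (Fin n) K d).subtype (Submodule.restrictScalars K I))

end Defs

/-- `m` is the exponent of the initial (largest) monomial of `p` w.r.t. the order `le`. -/
def IsInitialExp {K : Type*} [Field K] {n : ℕ}
    (le : (Fin n →₀ ℕ) → (Fin n →₀ ℕ) → Prop)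
    (p : MvPolynomial (Fin n) K) (m : Fin n →₀ ℕ) : Prop :=
  m ∈ p.support ∧ ∀ m' ∈ p.support, le m' m

/-- The initial ideal of `I` w.r.t. the order `le`. -/
noncomputable def initialIdeal {K : Type*} [Field K] {n : ℕ}
    (le : (Fin n →₀ ℕ) → (Fin n →₀ ℕ) → Prop)
    (I : Ideal (MvPolynomial (Fin n) K)) : Ideal (MvPolynomial (Fin n) K) :=
  Ideal.span { q | ∃ p ∈ I, ∃ m : Fin n →₀ ℕ, IsInitialExp le p m ∧
    q = (monomial m (1 : K) : MvPolynomial (Fin n) K) }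

namespace ClementsLindstrom

/-- The points `x` of total degree `d` with `x i < k i` for `i ∈ F` and `x i = c i` for `i ∉ F`. -/
def level {n : ℕ} (k : Fin n → ℕ) (F : Finset (Fin n)) (c : Fin n → ℕ) (d : ℕ) :
    Finset (Fin n → ℕ) :=
  (Fintype.piFinset fun i => if i ∈ F then Finset.range (k i) else {c i}).filter
    fun x => ∑ i, x i = d

/-- The upper shadow of `A` in the box `x i < k i`, `i ∈ F`. -/
def shadow {n : ℕ} (k : Fin n → ℕ) (F : Finset (Fin n)) (A : Finset (Fin n → ℕ)) :
    Finset (Fin n → ℕ) :=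
  ((A ×ˢ F).image fun p => p.1 + Pi.single p.2 1).filter fun x => ∀ i ∈ F, x i < k i

/-- `L` is a lex-segment of the level `d` of a box. -/
def IsSeg {n : ℕ} (k : Fin n → ℕ) (F : Finset (Fin n)) (c : Fin n → ℕ) (d : ℕ)
    (L : Finset (Fin n → ℕ)) : Prop :=
  L ⊆ level k F c d ∧ ∀ x ∈ L, ∀ y ∈ level k F c d, toLex x ≤ toLex y → y ∈ L

/-- Stability of `W` under the exchange of a variable for a larger one inside the box. -/
def IsStable {n : ℕ} (k : Fin n → ℕ) (F : Finset (Fin n)) (c : Fin n → ℕ) (d : ℕ)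
    (W : Finset (Fin n → ℕ)) : Prop :=
  ∀ w ∈ W, ∀ v ∈ level k F c d, ∀ i ∈ F, ∀ j ∈ F, j < i →
    v + Pi.single i 1 = w + Pi.single j 1 → v ∈ W

variable {n : ℕ} {k : Fin n → ℕ} {F : Finset (Fin n)} {c : Fin n → ℕ} {d : ℕ}

lemma mem_level {x : Fin n → ℕ} : x ∈ level k F c d ↔
    (∀ i ∈ F, x i < k i) ∧ (∀ i ∉ F, x i = c i) ∧ ∑ i, x i = d := by
  simp only [level, Finset.mem_filter, Fintype.mem_piFinset, ← and_assoc]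
  refine and_congr_left fun _ => ⟨fun h => ⟨fun i hi => ?_, fun i hi => ?_⟩, fun h i => ?_⟩
  · simpa [hi] using h i
  · simpa [hi] using h i
  · by_cases hi : i ∈ F
    · simpa [hi] using h.1 i hi
    · simpa [hi] using h.2 i hi

lemma mem_shadow {A : Finset (Fin n → ℕ)} {x : Fin n → ℕ} : x ∈ shadow k F A ↔
    (∀ i ∈ F, x i < k i) ∧ ∃ w ∈ A, ∃ i ∈ F, w + Pi.single i 1 = x := by
  simp only [shadow, Finset.mem_filter, Finset.mem_image, Finset.mem_product, Prod.exists]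
  constructor
  · rintro ⟨⟨w, i, ⟨hw, hi⟩, rfl⟩, h⟩
    exact ⟨h, w, hw, i, hi, rfl⟩
  · rintro ⟨h, w, hw, i, hi, rfl⟩
    exact ⟨⟨w, i, ⟨hw, hi⟩, rfl⟩, h⟩

lemma shadow_mono {A B : Finset (Fin n → ℕ)} (h : A ⊆ B) : shadow k F A ⊆ shadow k F B := by
  intro x hx
  rw [mem_shadow] at hx ⊢
  obtain ⟨h1, w, hw, h2⟩ := hx
  exact ⟨h1, w, h hw, h2⟩

lemma sum_add_single (x : Fin n → ℕ) (i : Fin n) :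
    ∑ j, (x + Pi.single i 1 : Fin n → ℕ) j = ∑ j, x j + 1 := by
  simp [Finset.sum_add_distrib]

lemma add_single_ne (x : Fin n → ℕ) {i j : Fin n} (h : j ≠ i) :
    (x + Pi.single i 1 : Fin n → ℕ) j = x j := by
  simp [h]

lemma add_single_self (x : Fin n → ℕ) (i : Fin n) :
    (x + Pi.single i 1 : Fin n → ℕ) i = x i + 1 := by
  simp

lemma le_add_single (x : Fin n → ℕ) (i j : Fin n) :
    x j ≤ (x + Pi.single i 1 : Fin n → ℕ) j := by
  simp

lemma shadow_subset_level {A : Finset (Fin n → ℕ)} (hA : A ⊆ level k F c d) :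
    shadow k F A ⊆ level k F c (d + 1) := by
  intro x hx
  rw [mem_shadow] at hx
  obtain ⟨h1, w, hw, i, hi, rfl⟩ := hx
  obtain ⟨-, h3, h4⟩ := mem_level.1 (hA hw)
  refine mem_level.2 ⟨h1, fun j hj => ?_, ?_⟩
  · rw [add_single_ne _ (ne_of_mem_of_not_mem hi hj).symm, h3 j hj]
  · rw [sum_add_single, h4]

lemma exists_of_lex_lt {x y : Fin n → ℕ} (h : toLex x < toLex y) :
    ∃ i, (∀ j < i, x j = y j) ∧ x i < y i := h

lemma lex_lt_of_le {x y : Fin n → ℕ} {p : Fin n} (h : ∀ j ≤ p, x j ≤ y j) (hp : x p < y p) :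
    toLex x < toLex y := by
  by_contra hlt
  rcases (not_lt.1 hlt).eq_or_lt with he | hl
  · have : y = x := toLex.injective he
    simp [this] at hp
  · obtain ⟨t, ht, ht'⟩ := exists_of_lex_lt hl
    rcases le_or_gt t p with htp | htp
    · exact absurd (h t htp) (by omega)
    · have := ht p htp
      omega

lemma eq_of_le_of_sum_eq {x y : Fin n → ℕ} (h : ∀ j, x j ≤ y j) (hs : ∑ j, x j = ∑ j, y j) :
    x = y :=
  funext fun j => (Finset.sum_eq_sum_iff_of_le fun i _ => h i).1 hs j (Finset.mem_univ j)

lemma sum_free_eq {x y : Fin n → ℕ} (hx : x ∈ level k F c d) (hy : y ∈ level k F c d) :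
    ∑ i ∈ F, x i = ∑ i ∈ F, y i := by
  obtain ⟨-, hx2, hx3⟩ := mem_level.1 hx
  obtain ⟨-, hy2, hy3⟩ := mem_level.1 hy
  have e : ∑ i ∈ Fᶜ, x i = ∑ i ∈ Fᶜ, y i := Finset.sum_congr rfl fun i hi => by
    rw [hx2 i (Finset.mem_compl.1 hi), hy2 i (Finset.mem_compl.1 hi)]
  have e1 := Finset.sum_add_sum_compl F x
  have e2 := Finset.sum_add_sum_compl F y
  omega

lemma mem_of_ne {x y : Fin n → ℕ} {d' : ℕ} (hx : x ∈ level k F c d) (hy : y ∈ level k F c d')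
    {i : Fin n} (h : x i ≠ y i) : i ∈ F := by
  by_contra hi
  exact h (((mem_level.1 hx).2.1 i hi).trans ((mem_level.1 hy).2.1 i hi).symm)

lemma IsSeg.subset_or_subset {L L' : Finset (Fin n → ℕ)} (h : IsSeg k F c d L)
    (h' : IsSeg k F c d L') : L ⊆ L' ∨ L' ⊆ L := by
  by_contra! hc
  obtain ⟨x, hx, hx'⟩ := Finset.not_subset.1 hc.1
  obtain ⟨y, hy, hy'⟩ := Finset.not_subset.1 hc.2
  rcases le_total (toLex x) (toLex y) with hle | hle
  · exact hy' (h.2 x hx y (h'.1 hy) hle)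
  · exact hx' (h'.2 y hy x (h.1 hx) hle)

lemma exists_seg : ∀ m ≤ (level k F c d).card, ∃ L, IsSeg k F c d L ∧ L.card = m := by
  intro m
  induction m with
  | zero => exact fun _ => ⟨∅, ⟨by simp, by simp⟩, by simp⟩
  | succ m ih =>
    intro hm
    obtain ⟨L, hL, hc⟩ := ih (by omega)
    have hne : (level k F c d \ L).Nonempty := by
      rw [← Finset.card_pos, Finset.card_sdiff_of_subset hL.1]
      omega
    obtain ⟨x, hx, hmax⟩ := Finset.exists_max_image _ (fun x => toLex x) hne
    rw [Finset.mem_sdiff] at hx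
    refine ⟨insert x L, ⟨Finset.insert_subset hx.1 hL.1, fun z hz y hy hle => ?_⟩, ?_⟩
    · by_cases hyL : y ∈ L
      · exact Finset.mem_insert_of_mem hyL
      rcases Finset.mem_insert.1 hz with rfl | hz
      · have := hmax y (Finset.mem_sdiff.2 ⟨hy, hyL⟩)
        rw [toLex.injective (le_antisymm this hle)]
        exact Finset.mem_insert_self _ _
      · exact absurd (hL.2 z hz y hy hle) hyL
    · rw [Finset.card_insert_of_notMem hx.2, hc]

/-- A point of positive free degree dominates a point of the previous level,
obtained by lowering its last nonzero free coordinate. -/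
lemma IsSeg.shadow {L : Finset (Fin n → ℕ)} (hL : IsSeg k F c d L) :
    IsSeg k F c (d + 1) (shadow k F L) := by
  refine ⟨shadow_subset_level hL.1, fun v hv v' hv' hle => ?_⟩
  have hvl := shadow_subset_level hL.1 hv
  obtain ⟨-, w, hw, i, hi, rfl⟩ := mem_shadow.1 hv
  obtain ⟨hb, ho, hs⟩ := mem_level.1 hv'
  have hwl := mem_level.1 (hL.1 hw)
  have hne : (F.filter fun j => 0 < v' j).Nonempty := by
    by_contra hemp
    rw [Finset.not_nonempty_iff_eq_empty, Finset.filter_eq_empty_iff] at hemp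
    have h0 : ∑ j ∈ F, v' j = 0 := Finset.sum_eq_zero fun j hj => by
      have := hemp hj
      omega
    rw [sum_free_eq hv' hvl] at h0
    have := Finset.sum_eq_zero_iff.1 h0 i hi
    rw [add_single_self] at this
    omega
  obtain ⟨q, hq, hqmax⟩ := Finset.exists_max_image _ id hne
  rw [Finset.mem_filter] at hq
  obtain ⟨z, rfl⟩ : ∃ z : Fin n → ℕ, v' = z + Pi.single q 1 := by
    refine ⟨fun j => v' j - (Pi.single q 1 : Fin n → ℕ) j, funext fun j => ?_⟩
    by_cases hj : j = q
    · subst hj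
      simp
      omega
    · simp [hj]
  have hqz : ∀ j ∈ F, q < j → z j = 0 := fun j hj hlt => by
    by_contra h0
    have := hqmax j (Finset.mem_filter.2 ⟨hj, by
      have := le_add_single z q j
      omega⟩)
    exact absurd this (not_le.2 hlt)
  rw [sum_add_single] at hs
  have hzl : z ∈ level k F c d := by
    refine mem_level.2 ⟨fun j hj => (le_add_single z q j).trans_lt (hb j hj), fun j hj => ?_,
      by omega⟩
    rw [← ho j hj, add_single_ne _ (ne_of_mem_of_not_mem hq.1 hj).symm]
  refine mem_shadow.2 ⟨hb, z, hL.2 w hw z hzl ?_, q, hq.1, rfl⟩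
  by_contra hlt
  obtain ⟨p, hp, hp'⟩ := exists_of_lex_lt (not_le.1 hlt)
  rcases lt_or_ge p q with hpq | hpq
  · refine absurd hle (not_le.2 (lex_lt_of_le (p := p) (fun j hj => ?_) ?_))
    · rw [add_single_ne _ (hj.trans_lt hpq).ne]
      refine le_trans ?_ (le_add_single w i j)
      rcases hj.eq_or_lt with rfl | hj
      · exact hp'.le
      · exact (hp j hj).le
    · rw [add_single_ne _ hpq.ne]
      exact hp'.trans_le (le_add_single w i p)
  · have hzw : z = w := by
      refine eq_of_le_of_sum_eq (fun j => ?_) (by omega)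
      rcases lt_trichotomy j p with h | rfl | h
      · exact (hp j h).le
      · exact hp'.le
      · by_cases hj : j ∈ F
        · rw [hqz j hj (hpq.trans_lt h)]
          exact Nat.zero_le _
        · rw [(mem_level.1 hzl).2.1 j hj, hwl.2.1 j hj]
    rw [hzw] at hp'
    exact lt_irrefl _ hp'

lemma IsSeg.isStable {L : Finset (Fin n → ℕ)} (hL : IsSeg k F c d L) : IsStable k F c d L := by
  intro w hw v hv i _ j _ hji h
  refine hL.2 w hw v hv (lex_lt_of_le (p := j) (fun m hm => ?_) ?_).le
  · have := congrFun h m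
    rw [add_single_ne _ (hm.trans_lt hji).ne] at this
    rw [this]
    exact le_add_single _ _ _
  · have := congrFun h j
    rw [add_single_ne _ hji.ne, add_single_self] at this
    omega

lemma mem_level_section {x : Fin n → ℕ} {i : Fin n} (hi : i ∈ F) {t : ℕ} (ht : t < k i) :
    x ∈ level k (F.erase i) (Function.update c i t) d ↔ x ∈ level k F c d ∧ x i = t := by
  rw [mem_level, mem_level]
  constructor
  · rintro ⟨h1, h2, h3⟩
    have hxi : x i = t := by simpa using h2 i (by simp)
    refine ⟨⟨fun j hj => ?_, fun j hj => ?_, h3⟩, hxi⟩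
    · by_cases hji : j = i
      · rw [hji, hxi]
        exact ht
      · exact h1 j (Finset.mem_erase.2 ⟨hji, hj⟩)
    · have hji : j ≠ i := fun h => hj (h ▸ hi)
      simpa [hji] using h2 j (by simp [hj])
  · rintro ⟨⟨h1, h2, h3⟩, hxi⟩
    refine ⟨fun j hj => h1 j (Finset.mem_of_mem_erase hj), fun j hj => ?_, h3⟩
    by_cases hji : j = i
    · simp [hji, hxi]
    · simpa [hji] using h2 j fun h => hj (Finset.mem_erase.2 ⟨hji, h⟩)

lemma IsSeg.filter {L : Finset (Fin n → ℕ)} (hL : IsSeg k F c d L) {i : Fin n} (hi : i ∈ F)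
    {t : ℕ} (ht : t < k i) :
    IsSeg k (F.erase i) (Function.update c i t) d (L.filter fun x => x i = t) := by
  refine ⟨fun x hx => ?_, fun x hx y hy hle => ?_⟩
  · rw [Finset.mem_filter] at hx
    exact (mem_level_section hi ht).2 ⟨hL.1 hx.1, hx.2⟩
  · rw [Finset.mem_filter] at hx ⊢
    rw [mem_level_section hi ht] at hy
    exact ⟨hL.2 x hx.1 y hy.1 hle, hy.2⟩

lemma lex_add_single_le_iff {x y : Fin n → ℕ} {i : Fin n} :
    toLex (x + Pi.single i 1) ≤ toLex (y + Pi.single i 1) ↔ toLex x ≤ toLex y := by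
  rw [← not_lt, ← not_lt, not_iff_not]
  refine exists_congr fun p => and_congr (forall₂_congr fun j _ => ?_) ?_
  · simp
  · simp

lemma IsSeg.image_add_single {L : Finset (Fin n → ℕ)} {i : Fin n} (hi : i ∉ F) {t : ℕ}
    (hL : IsSeg k F (Function.update c i t) d L) :
    IsSeg k F (Function.update c i (t + 1)) (d + 1) (L.image fun x => x + Pi.single i 1) := by
  refine ⟨fun x hx => ?_, fun x hx y hy hle => ?_⟩
  · obtain ⟨w, hw, rfl⟩ := Finset.mem_image.1 hx
    obtain ⟨h1, h2, h3⟩ := mem_level.1 (hL.1 hw)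
    refine mem_level.2 ⟨fun j hj => ?_, fun j hj => ?_, by rw [sum_add_single, h3]⟩
    · rw [add_single_ne _ (ne_of_mem_of_not_mem hj hi)]
      exact h1 j hj
    · have := h2 j hj
      by_cases hji : j = i
      · subst hji
        rw [add_single_self]
        simpa using this
      · rw [add_single_ne _ hji]
        simpa [hji] using this
  · obtain ⟨w, hw, rfl⟩ := Finset.mem_image.1 hx
    obtain ⟨h1, h2, h3⟩ := mem_level.1 hy
    have hyi : y i = t + 1 := by simpa using h2 i hi
    obtain ⟨z, rfl⟩ : ∃ z : Fin n → ℕ, y = z + Pi.single i 1 := by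
      refine ⟨Function.update y i t, funext fun j => ?_⟩
      by_cases hj : j = i
      · subst hj
        simp [hyi]
      · simp [hj]
    refine Finset.mem_image.2 ⟨z, hL.2 w hw z (mem_level.2 ⟨fun j hj => ?_, fun j hj => ?_, ?_⟩)
      (lex_add_single_le_iff.1 hle), rfl⟩
    · exact (le_add_single z i j).trans_lt (h1 j hj)
    · have := h2 j hj
      by_cases hji : j = i
      · subst hji
        rw [add_single_self] at this
        simpa using this
      · rw [add_single_ne _ hji] at this
        simpa [hji] using this
    · rw [sum_add_single] at h3
      omega

lemma shadow_filter_zero {A : Finset (Fin n → ℕ)} {i : Fin n} (hi : i ∈ F) (ht : 0 < k i) :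
    (shadow k F A).filter (fun x => x i = 0) =
      shadow k (F.erase i) (A.filter fun x => x i = 0) := by
  ext x
  simp only [Finset.mem_filter, mem_shadow]
  constructor
  · rintro ⟨⟨h1, w, hw, j, hj, rfl⟩, h0⟩
    have hji : j ≠ i := by
      rintro rfl
      rw [add_single_self] at h0
      omega
    rw [add_single_ne _ hji.symm] at h0
    exact ⟨fun m hm => h1 m (Finset.mem_of_mem_erase hm), w, ⟨hw, h0⟩, j,
      Finset.mem_erase.2 ⟨hji, hj⟩, rfl⟩
  · rintro ⟨h1, w, ⟨hw, h0⟩, j, hj, rfl⟩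
    rw [Finset.mem_erase] at hj
    have e := add_single_ne w hj.1.symm
    refine ⟨⟨fun m hm => ?_, w, hw, j, hj.2, rfl⟩, by rw [e, h0]⟩
    by_cases hmi : m = i
    · rw [hmi, e, h0]
      exact ht
    · exact h1 m (Finset.mem_erase.2 ⟨hmi, hm⟩)

lemma shadow_filter_succ {A : Finset (Fin n → ℕ)} (hA : A ⊆ level k F c d) {i : Fin n}
    (hi : i ∈ F) {t : ℕ} (ht : t + 1 < k i) :
    (shadow k F A).filter (fun x => x i = t + 1) =
      shadow k (F.erase i) (A.filter fun x => x i = t + 1) ∪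
        (A.filter fun x => x i = t).image fun x => x + Pi.single i 1 := by
  ext x
  simp only [Finset.mem_filter, mem_shadow, Finset.mem_union, Finset.mem_image]
  constructor
  · rintro ⟨⟨h1, w, hw, j, hj, rfl⟩, h0⟩
    by_cases hji : j = i
    · subst hji
      rw [add_single_self] at h0
      exact Or.inr ⟨w, ⟨hw, by omega⟩, rfl⟩
    · rw [add_single_ne _ (Ne.symm hji)] at h0
      exact Or.inl ⟨fun m hm => h1 m (Finset.mem_of_mem_erase hm), w, ⟨hw, h0⟩, j,
        Finset.mem_erase.2 ⟨hji, hj⟩, rfl⟩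
  · rintro (⟨h1, w, ⟨hw, h0⟩, j, hj, rfl⟩ | ⟨w, ⟨hw, h0⟩, rfl⟩)
    · rw [Finset.mem_erase] at hj
      have e := add_single_ne w hj.1.symm
      refine ⟨⟨fun m hm => ?_, w, hw, j, hj.2, rfl⟩, by rw [e, h0]⟩
      by_cases hmi : m = i
      · rw [hmi, e, h0]
        exact ht
      · exact h1 m (Finset.mem_erase.2 ⟨hmi, hm⟩)
    · refine ⟨⟨fun m hm => ?_, w, hw, i, hi, rfl⟩, by rw [add_single_self, h0]⟩
      by_cases hmi : m = i
      · rw [hmi, add_single_self, h0]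
        exact ht
      · rw [add_single_ne _ hmi]
        exact (mem_level.1 (hA hw)).1 m hm

lemma add_single_injective (i : Fin n) :
    Function.Injective fun x : Fin n → ℕ => x + Pi.single i 1 :=
  add_left_injective _

/-- Among sets of equal size, a lex-segment maximizes the sum of an increasing weight. -/
lemma IsSeg.eq_or_sum_lt {L A : Finset (Fin n → ℕ)} (hL : IsSeg k F c d L)
    (hA : A ⊆ level k F c d) (hcard : A.card = L.card) {φ : (Fin n → ℕ) → ℕ}
    (hφ : ∀ x ∈ level k F c d, ∀ y ∈ level k F c d, toLex x < toLex y → φ x < φ y) :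
    A = L ∨ ∑ x ∈ A, φ x < ∑ x ∈ L, φ x := by
  rw [or_iff_not_imp_left]
  intro hne
  have h1 : (A \ L).card = (L \ A).card := Finset.card_sdiff_comm hcard
  have hne1 : (A \ L).Nonempty := by
    rw [Finset.sdiff_nonempty]
    exact fun h => hne (Finset.eq_of_subset_of_card_le h hcard.ge)
  have hne2 : (L \ A).Nonempty := by
    rw [← Finset.card_pos, ← h1]
    exact hne1.card_pos
  obtain ⟨z, hz, hmin⟩ := Finset.exists_min_image _ φ hne2
  rw [Finset.mem_sdiff] at hz
  have hlt : ∑ x ∈ A \ L, φ x < (A \ L).card • φ z :=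
    (Finset.sum_lt_sum_of_nonempty hne1 fun x hx => by
      rw [Finset.mem_sdiff] at hx
      exact hφ x (hA hx.1) z (hL.1 hz.1)
        (not_le.1 fun hle => hx.2 (hL.2 z hz.1 x (hA hx.1) hle))).trans_eq
      (Finset.sum_const _)
  have hle : (L \ A).card • φ z ≤ ∑ x ∈ L \ A, φ x := Finset.card_nsmul_le_sum _ _ _ hmin
  rw [h1] at hlt
  have e1 := Finset.sum_inter_add_sum_sdiff A L φ
  have e2 := Finset.sum_inter_add_sum_sdiff L A φ
  rw [Finset.inter_comm] at e2
  omega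

lemma sum_filter_eq {M : Type*} [AddCommMonoid M] {A : Finset (Fin n → ℕ)}
    {i : Fin n} {m : ℕ} (hA : ∀ x ∈ A, x i < m) (φ : (Fin n → ℕ) → M) :
    ∑ t ∈ Finset.range m, ∑ x ∈ A.filter (fun x => x i = t), φ x = ∑ x ∈ A, φ x :=
  Finset.sum_fiberwise_of_maps_to (fun x hx => Finset.mem_range.2 (hA x hx)) φ

lemma card_filter_eq {A : Finset (Fin n → ℕ)} {i : Fin n} {m : ℕ} (hA : ∀ x ∈ A, x i < m) :
    ∑ t ∈ Finset.range m, (A.filter fun x => x i = t).card = A.card := by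
  simp only [Finset.card_eq_sum_ones]
  exact sum_filter_eq hA _

/-- Replacing all sections `x i = t` of `A` by lex-segments of the same size. -/
lemma exists_compression {i : Fin n} (hi : i ∈ F)
    (ih : ∀ c d A L, A ⊆ level k (F.erase i) c d → IsSeg k (F.erase i) c d L →
      L.card ≤ A.card → (shadow k (F.erase i) L).card ≤ (shadow k (F.erase i) A).card)
    {A : Finset (Fin n → ℕ)} (hA : A ⊆ level k F c d) {φ : (Fin n → ℕ) → ℕ}
    (hφ : ∀ x ∈ level k F c d, ∀ y ∈ level k F c d, toLex x < toLex y → φ x < φ y) :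
    ∃ C ⊆ level k F c d, C.card = A.card ∧ (shadow k F C).card ≤ (shadow k F A).card ∧
      (∀ t < k i, IsSeg k (F.erase i) (Function.update c i t) d (C.filter fun x => x i = t)) ∧
      (A = C ∨ ∑ x ∈ A, φ x < ∑ x ∈ C, φ x) := by
  have hlt : ∀ {d} {B : Finset (Fin n → ℕ)}, B ⊆ level k F c d → ∀ x ∈ B, x i < k i :=
    fun hB x hx => (mem_level.1 (hB hx)).1 i hi
  have hsec : ∀ t < k i, (A.filter fun x => x i = t) ⊆
      level k (F.erase i) (Function.update c i t) d := fun t ht x hx => by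
    rw [Finset.mem_filter] at hx
    exact (mem_level_section hi ht).2 ⟨hA hx.1, hx.2⟩
  have hex : ∀ t, ∃ S, t < k i → IsSeg k (F.erase i) (Function.update c i t) d S ∧
      S.card = (A.filter fun x => x i = t).card := fun t => by
    by_cases ht : t < k i
    · obtain ⟨S, hS⟩ := exists_seg _ (Finset.card_le_card (hsec t ht))
      exact ⟨S, fun _ => hS⟩
    · exact ⟨∅, fun h => absurd h ht⟩
  choose S hS using hex
  set C := (Finset.range (k i)).biUnion S with hCdef
  have hSm : ∀ t < k i, ∀ x ∈ S t, x ∈ level k F c d ∧ x i = t := fun t ht x hx =>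
    (mem_level_section hi ht).1 ((hS t ht).1.1 hx)
  have hC : C ⊆ level k F c d := fun x hx => by
    obtain ⟨t, ht, hxt⟩ := Finset.mem_biUnion.1 hx
    exact (hSm t (Finset.mem_range.1 ht) x hxt).1
  have hCt : ∀ t < k i, (C.filter fun x => x i = t) = S t := fun t ht => by
    ext x
    rw [Finset.mem_filter, Finset.mem_biUnion]
    constructor
    · rintro ⟨⟨s, hs, hxs⟩, hxt⟩
      rw [← hxt, (hSm s (Finset.mem_range.1 hs) x hxs).2]
      exact hxs
    · intro hx
      exact ⟨⟨t, Finset.mem_range.2 ht, hx⟩, (hSm t ht x hx).2⟩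
  have hcard : ∀ t < k i, (C.filter fun x => x i = t).card = (A.filter fun x => x i = t).card :=
    fun t ht => by rw [hCt t ht, (hS t ht).2]
  have hseg : ∀ t < k i, IsSeg k (F.erase i) (Function.update c i t) d
      (C.filter fun x => x i = t) := fun t ht => by
    rw [hCt t ht]
    exact (hS t ht).1
  refine ⟨C, hC, ?_, ?_, hseg, ?_⟩
  · rw [← card_filter_eq (hlt hC), ← card_filter_eq (hlt hA)]
    exact Finset.sum_congr rfl fun t ht => hcard t (Finset.mem_range.1 ht)
  · rw [← card_filter_eq (hlt (shadow_subset_level hC)),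
      ← card_filter_eq (hlt (shadow_subset_level hA))]
    refine Finset.sum_le_sum fun t ht => ?_
    rw [Finset.mem_range] at ht
    have hsh := ih _ _ _ _ (hsec t ht) (hseg t ht) (hcard t ht).le
    cases t with
    | zero => rwa [shadow_filter_zero hi ht, shadow_filter_zero hi ht]
    | succ t =>
      rw [shadow_filter_succ hC hi ht, shadow_filter_succ hA hi ht]
      have hsh' : ((C.filter fun x => x i = t).image fun x => x + Pi.single i 1).card =
          ((A.filter fun x => x i = t).image fun x => x + Pi.single i 1).card := by
        rw [Finset.card_image_of_injective _ (add_single_injective i),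
          Finset.card_image_of_injective _ (add_single_injective i), hcard t (by omega)]
      rcases ((hseg _ ht).shadow).subset_or_subset
          ((hseg t (by omega)).image_add_single (Finset.notMem_erase i F)) with h | h
      · rw [Finset.union_eq_right.2 h, hsh']
        exact Finset.card_le_card Finset.subset_union_right
      · rw [Finset.union_eq_left.2 h]
        exact hsh.trans (Finset.card_le_card Finset.subset_union_left)
  · have hsum : ∀ t < k i, (A.filter fun x => x i = t) = (C.filter fun x => x i = t) ∨
        ∑ x ∈ A.filter (fun x => x i = t), φ x < ∑ x ∈ C.filter (fun x => x i = t), φ x :=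
      fun t ht => (hseg t ht).eq_or_sum_lt (hsec t ht) (hcard t ht).symm
        fun x hx y hy => hφ x ((mem_level_section hi ht).1 hx).1 y
          ((mem_level_section hi ht).1 hy).1
    by_cases hall : ∀ t < k i, (A.filter fun x => x i = t) = (C.filter fun x => x i = t)
    · left
      ext x
      have key : ∀ t < k i, x i = t → (x ∈ A ↔ x ∈ C) := fun t ht hxt => by
        have := Finset.ext_iff.1 (hall t ht) x
        simpa [Finset.mem_filter, hxt] using this
      exact ⟨fun hx => (key _ (hlt hA x hx) rfl).1 hx, fun hx => (key _ (hlt hC x hx) rfl).2 hx⟩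
    · right
      push Not at hall
      obtain ⟨t, ht, htne⟩ := hall
      rw [← sum_filter_eq (hlt hA), ← sum_filter_eq (hlt hC)]
      refine Finset.sum_lt_sum (fun s hs => ?_) ⟨t, Finset.mem_range.2 ht, ?_⟩
      · rcases hsum s (Finset.mem_range.1 hs) with h | h
        · rw [h]
        · exact h.le
      · exact (hsum t ht).resolve_left htne

/-- A set that is not increased by any compression can be chosen with a shadow as small. -/
lemma exists_compressed
    (ih : ∀ i ∈ F, ∀ c d A L, A ⊆ level k (F.erase i) c d → IsSeg k (F.erase i) c d L →
      L.card ≤ A.card → (shadow k (F.erase i) L).card ≤ (shadow k (F.erase i) A).card)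
    {A : Finset (Fin n → ℕ)} (hA : A ⊆ level k F c d) :
    ∃ C ⊆ level k F c d, C.card = A.card ∧ (shadow k F C).card ≤ (shadow k F A).card ∧
      ∀ i ∈ F, ∀ t < k i,
        IsSeg k (F.erase i) (Function.update c i t) d (C.filter fun x => x i = t) := by
  classical
  let φ : (Fin n → ℕ) → ℕ := fun x => ((level k F c d).filter fun y => toLex y < toLex x).card
  have hφ : ∀ x ∈ level k F c d, ∀ y ∈ level k F c d, toLex x < toLex y → φ x < φ y := by
    intro x hx y _ hxy
    refine Finset.card_lt_card ⟨fun z hz => ?_, fun h => ?_⟩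
    · rw [Finset.mem_filter] at hz ⊢
      exact ⟨hz.1, hz.2.trans hxy⟩
    · exact lt_irrefl _ (Finset.mem_filter.1 (h (Finset.mem_filter.2 ⟨hx, hxy⟩))).2
  obtain ⟨B, hB, hmax⟩ := Finset.exists_max_image
    ((level k F c d).powerset.filter fun B =>
      B.card = A.card ∧ (shadow k F B).card ≤ (shadow k F A).card)
    (fun B => ∑ x ∈ B, φ x)
    ⟨A, Finset.mem_filter.2 ⟨Finset.mem_powerset.2 hA, rfl, le_rfl⟩⟩
  rw [Finset.mem_filter, Finset.mem_powerset] at hB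
  obtain ⟨hBl, hBc, hBs⟩ := hB
  refine ⟨B, hBl, hBc, hBs, fun i hi => ?_⟩
  obtain ⟨C, hC, hCc, hCs, hseg, heq⟩ := exists_compression hi (ih i hi) hBl hφ
  have hBC : B = C := heq.resolve_right (not_lt.2 (hmax C (Finset.mem_filter.2
    ⟨Finset.mem_powerset.2 hC, hCc.trans hBc, hCs.trans hBs⟩)))
  rw [hBC]
  exact hseg

/-- The shadow of a stable set is determined by multiplication by the last variable and the
shadow of the section where the last variable does not occur. -/
lemma IsStable.card_shadow {W : Finset (Fin n → ℕ)} (hW : W ⊆ level k F c d)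
    (hst : IsStable k F c d W) {l : Fin n} (hl : l ∈ F) (hmax : ∀ j ∈ F, j ≤ l) (hk : 0 < k l) :
    (shadow k F W).card = (W.filter fun x => x l < k l - 1).card +
      (shadow k (F.erase l) (W.filter fun x => x l = 0)).card := by
  rw [← shadow_filter_zero hl hk, add_comm,
    ← Finset.card_filter_add_card_filter_not (s := shadow k F W) (fun x => x l = 0),
    ← Finset.card_image_of_injective (W.filter fun x => x l < k l - 1) (add_single_injective l)]
  congr 2
  ext x
  simp only [Finset.mem_filter, Finset.mem_image]
  constructor
  · rintro ⟨hx, h0⟩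
    have hxl := mem_level.1 (shadow_subset_level hW hx)
    obtain ⟨-, w, hw, i, hi, rfl⟩ := mem_shadow.1 hx
    obtain ⟨v, hv⟩ : ∃ v : Fin n → ℕ, v + Pi.single l 1 = w + Pi.single i 1 := by
      refine ⟨fun j => (w + Pi.single i 1 : Fin n → ℕ) j - (Pi.single l 1 : Fin n → ℕ) j,
        funext fun j => ?_⟩
      by_cases hj : j = l
      · subst hj
        simp only [Pi.add_apply, Pi.single_eq_same] at h0 ⊢
        omega
      · simp [hj]
    rw [← hv] at hxl ⊢
    have hvb : v l < k l - 1 := by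
      have := hxl.1 l hl
      rw [add_single_self] at this
      omega
    refine ⟨v, ⟨?_, hvb⟩, rfl⟩
    by_cases hil : i = l
    · subst hil
      rw [add_single_injective i hv]
      exact hw
    · refine hst w hw v (mem_level.2 ⟨fun j hj => ?_, fun j hj => ?_, ?_⟩) l hl i hi
        (lt_of_le_of_ne (hmax i hi) hil) hv
      · exact (le_add_single v l j).trans_lt (hxl.1 j hj)
      · rw [← hxl.2.1 j hj, add_single_ne _ (ne_of_mem_of_not_mem hl hj).symm]
      · have := hxl.2.2
        rw [sum_add_single] at this
        omega
  · rintro ⟨v, ⟨hv, hvl⟩, rfl⟩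
    refine ⟨mem_shadow.2 ⟨fun j hj => ?_, v, hv, l, hl, rfl⟩, by simp⟩
    by_cases hjl : j = l
    · subst hjl
      rw [add_single_self]
      omega
    · rw [add_single_ne _ hjl]
      exact (mem_level.1 (hW hv)).1 j hj

lemma mem_of_stable_of_compressed {W : Finset (Fin n → ℕ)} (hW : W ⊆ level k F c d)
    (hst : IsStable k F c d W) {l : Fin n} (hl : l ∈ F) (hmax : ∀ j ∈ F, j ≤ l)
    (hseg : ∀ t < k l,
      IsSeg k (F.erase l) (Function.update c l t) d (W.filter fun x => x l = t))
    {x : Fin n → ℕ} (hx : x ∈ level k F c d) : ∀ (m : ℕ) (y : Fin n → ℕ), y ∈ W →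
      toLex y ≤ toLex x → y l = x l + m → x ∈ W := by
  have hxl := mem_level.1 hx
  intro m
  induction m with
  | zero =>
    intro y hy hle heq
    exact (Finset.mem_filter.1 ((hseg (x l) (hxl.1 l hl)).2 y (Finset.mem_filter.2 ⟨hy, heq⟩) x
      ((mem_level_section hl (hxl.1 l hl)).2 ⟨hx, rfl⟩) hle)).1
  | succ m ih =>
    intro y hy hle heq
    have hyl := mem_level.1 (hW hy)
    obtain ⟨i, hi, hi'⟩ : ∃ i, (∀ j < i, y j = x j) ∧ y i < x i := by
      refine exists_of_lex_lt (lt_of_le_of_ne hle fun h => ?_)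
      have := congrFun (toLex.injective h) l
      omega
    obtain ⟨j, hj, hjmax⟩ := Finset.exists_max_image (Finset.univ.filter fun j => y j < x j) id
      ⟨i, Finset.mem_filter.2 ⟨Finset.mem_univ _, hi'⟩⟩
    have hjx := (Finset.mem_filter.1 hj).2
    have hij : i ≤ j := hjmax i (Finset.mem_filter.2 ⟨Finset.mem_univ _, hi'⟩)
    have hjF : j ∈ F := mem_of_ne (hW hy) hx hjx.ne
    have hjl : j ≠ l := by
      rintro rfl
      omega
    obtain ⟨z, hz⟩ : ∃ z : Fin n → ℕ, z + Pi.single l 1 = y + Pi.single j 1 := by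
      refine ⟨fun p => (y + Pi.single j 1 : Fin n → ℕ) p - (Pi.single l 1 : Fin n → ℕ) p,
        funext fun p => ?_⟩
      by_cases hp : p = l
      · subst hp
        simp [hjl.symm]
        omega
      · simp [hp]
    have hzl : z l + 1 = y l := by
      have := congrFun hz l
      rwa [add_single_self, add_single_ne _ hjl.symm] at this
    have hzj : z j = y j + 1 := by
      have := congrFun hz j
      rwa [add_single_self, add_single_ne _ hjl] at this
    have hzo : ∀ p, p ≠ l → p ≠ j → z p = y p := fun p hpl hpj => by
      have := congrFun hz p
      rwa [add_single_ne _ hpl, add_single_ne _ hpj] at this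
    have hzs : ∑ p, z p = d := by
      have : ∑ p, (z + Pi.single l 1 : Fin n → ℕ) p = ∑ p, (y + Pi.single j 1 : Fin n → ℕ) p := by
        rw [hz]
      rw [sum_add_single, sum_add_single, hyl.2.2] at this
      omega
    have hzlev : z ∈ level k F c d := by
      refine mem_level.2 ⟨fun p hp => ?_, fun p hp => ?_, hzs⟩
      · by_cases hpl : p = l
        · subst hpl
          have := hyl.1 p hp
          omega
        · by_cases hpj : p = j
          · subst hpj
            have := hxl.1 p hp
            omega
          · rw [hzo p hpl hpj]
            exact hyl.1 p hp
      · rw [hzo p (ne_of_mem_of_not_mem hl hp).symm (ne_of_mem_of_not_mem hjF hp).symm]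
        exact hyl.2.1 p hp
    refine ih z (hst y hy z hzlev l hl j hjF (lt_of_le_of_ne (hmax j hjF) hjl) hz) ?_ (by omega)
    have hil : i < l := hij.trans_lt (lt_of_le_of_ne (hmax j hjF) hjl)
    have hbefore : ∀ p < i, z p = x p := fun p hp => by
      rw [hzo p (hp.trans hil).ne (hp.trans_le hij).ne, hi p hp]
    by_cases hzi : z i < x i
    · refine (lex_lt_of_le (p := i) (fun p hp => ?_) hzi).le
      rcases hp.eq_or_lt with rfl | hp
      · exact hzi.le
      · exact (hbefore p hp).le
    · have hji : j = i := by
        by_contra hne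
        exact hzi ((hzo i hil.ne (Ne.symm hne)).trans_lt hi')
      subst hji
      have : x = z := by
        refine eq_of_le_of_sum_eq (fun p => ?_) (hxl.2.2.trans hzs.symm)
        by_cases hpl : p = l
        · subst hpl
          omega
        · rcases lt_trichotomy p j with h | rfl | h
          · exact (hbefore p h).ge
          · exact not_lt.1 hzi
          · rw [hzo p hpl h.ne']
            by_contra hlt
            exact absurd (hjmax p (Finset.mem_filter.2 ⟨Finset.mem_univ _, not_le.1 hlt⟩))
              (not_le.2 h)
      rw [this]

/-- Lex-segments have the fewest points with small last coordinate. -/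
lemma card_filter_lt_le {W L : Finset (Fin n → ℕ)} (hW : W ⊆ level k F c d)
    (hst : IsStable k F c d W) {l : Fin n} (hl : l ∈ F) (hmax : ∀ j ∈ F, j ≤ l)
    (hseg : ∀ t < k l,
      IsSeg k (F.erase l) (Function.update c l t) d (W.filter fun x => x l = t))
    (hL : IsSeg k F c d L) (hcard : L.card ≤ W.card) (m : ℕ) :
    (L.filter fun x => x l < m).card ≤ (W.filter fun x => x l < m).card := by
  by_contra! hlt
  obtain ⟨x, hx, hx'⟩ := Finset.exists_mem_notMem_of_card_lt_card hlt
  have e1 := Finset.card_filter_add_card_filter_not (s := L) (fun x => x l < m)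
  have e2 := Finset.card_filter_add_card_filter_not (s := W) (fun x => x l < m)
  obtain ⟨y, hy, hy'⟩ := Finset.exists_mem_notMem_of_card_lt_card
    (show (L.filter fun x => ¬ x l < m).card < (W.filter fun x => ¬ x l < m).card by omega)
  simp only [Finset.mem_filter, not_and, not_lt] at hx hx' hy hy'
  have hyL : y ∉ L := fun h => hy' h hy.2
  refine absurd (hx' (mem_of_stable_of_compressed hW hst hl hmax hseg (hL.1 hx.1) (y l - x l) y
    hy.1 ?_ (by omega))) (not_le.2 hx.2)
  by_contra hle
  exact hyL (hL.2 x hx.1 y (hW hy.1) (not_le.1 hle).le)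

lemma isStable_of_compressed {W : Finset (Fin n → ℕ)}
    (hF : 3 ≤ F.card) (hW : W ⊆ level k F c d)
    (hseg : ∀ i ∈ F, ∀ t < k i,
      IsSeg k (F.erase i) (Function.update c i t) d (W.filter fun x => x i = t)) :
    IsStable k F c d W := by
  intro w hw v hv i hi j hj hji h
  obtain ⟨p, hp⟩ : ((F.erase i).erase j).Nonempty := by
    rw [← Finset.card_pos, Finset.card_erase_of_mem (Finset.mem_erase.2 ⟨hji.ne, hj⟩),
      Finset.card_erase_of_mem hi]
    omega
  simp only [Finset.mem_erase] at hp
  obtain ⟨hpj, hpi, hpF⟩ := hp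
  have hwv : v p = w p := by
    have := congrFun h p
    rwa [add_single_ne _ hpi, add_single_ne _ hpj] at this
  have hlt := (mem_level.1 (hW hw)).1 p hpF
  refine (Finset.mem_filter.1 ((hseg p hpF (w p) hlt).2 w (Finset.mem_filter.2 ⟨hw, rfl⟩) v
    ((mem_level_section hpF hlt).2 ⟨hv, hwv⟩) (lex_lt_of_le (p := j) (fun m hm => ?_) ?_).le)).1
  · have := congrFun h m
    rw [add_single_ne _ (hm.trans_lt hji).ne] at this
    rw [this]
    exact le_add_single _ _ _
  · have := congrFun h j
    rw [add_single_ne _ hji.ne, add_single_self] at this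
    omega

lemma card_shadow_le_of_card_eq_two {i j : Fin n} (hij : i < j) (hk : k i ≤ k j)
    {A L : Finset (Fin n → ℕ)} (hA : A ⊆ level k {i, j} c d) (hL : IsSeg k {i, j} c d L)
    (hcard : L.card ≤ A.card) : (shadow k {i, j} L).card ≤ (shadow k {i, j} A).card := by
  by_cases hLA : L ⊆ A
  · exact Finset.card_le_card (shadow_mono hLA)
  obtain ⟨z, hz, hzA⟩ := Finset.not_subset.1 hLA
  obtain ⟨s, hs⟩ : ∃ s, ∀ x ∈ level k {i, j} c d, x i + x j = s := ⟨z i + z j, fun x hx => by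
    have := sum_free_eq hx (hL.1 hz)
    rwa [Finset.sum_pair hij.ne, Finset.sum_pair hij.ne] at this⟩
  have hbox : ∀ x ∈ level k {i, j} c d, x i < k i ∧ x j < k j := fun x hx =>
    ⟨(mem_level.1 hx).1 i (by simp), (mem_level.1 hx).1 j (by simp)⟩
  have heq : ∀ x ∈ level k {i, j} c d, ∀ y ∈ level k {i, j} c d, x i = y i → x = y := by
    intro x hx y hy h
    by_contra hne
    obtain ⟨p, hp⟩ := Function.ne_iff.1 hne
    have hpF := mem_of_ne hx hy hp
    have := hs x hx
    have := hs y hy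
    rcases Finset.mem_insert.1 hpF with rfl | hpF
    · exact hp h
    · rw [Finset.mem_singleton.1 hpF] at hp
      omega
  have hmem : ∀ x ∈ A, ∀ p ∈ ({i, j} : Finset (Fin n)), x p + 1 < k p →
      x + Pi.single p 1 ∈ shadow k {i, j} A := by
    intro x hx p hp hlt
    refine mem_shadow.2 ⟨fun q hq => ?_, x, hx, p, hp, rfl⟩
    by_cases hqp : q = p
    · rw [hqp, add_single_self]
      exact hlt
    · rw [add_single_ne _ hqp]
      exact (mem_level.1 (hA hx)).1 q hq
  have hLs := hL.isStable.card_shadow hL.1 (l := j) (by simp) (by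
    intro m hm
    rcases Finset.mem_insert.1 hm with rfl | hm
    · exact hij.le
    · exact (Finset.mem_singleton.1 hm).le) (by have := (hbox z (hL.1 hz)).2; omega)
  have hfil : (L.filter fun x => x j < k j - 1).card ≤ L.card :=
    Finset.card_le_card (Finset.filter_subset _ _)
  have herase : ({i, j} : Finset (Fin n)).erase j = {i} := by
    ext m
    simp only [Finset.mem_erase, Finset.mem_insert, Finset.mem_singleton]
    constructor
    · tauto
    · rintro rfl
      exact ⟨hij.ne, Or.inl rfl⟩
  rw [herase] at hLs
  have hrest : ∀ v ∈ shadow k {i} (L.filter fun x => x j = 0), v i = s + 1 ∧ v i < k i ∧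
      ∃ w ∈ L, w i = s ∧ w + Pi.single i 1 = v := by
    intro v hv
    obtain ⟨h1, w, hw, p, hp, rfl⟩ := mem_shadow.1 hv
    rw [Finset.mem_singleton] at hp
    subst hp
    rw [Finset.mem_filter] at hw
    have := hs w (hL.1 hw.1)
    refine ⟨by rw [add_single_self]; omega, h1 p (by simp), w, hw.1, by omega, rfl⟩
  by_cases hsi : s + 1 < k i
  · have h1 : (shadow k {i} (L.filter fun x => x j = 0)).card ≤ 1 := by
      refine Finset.card_le_one.2 fun a ha b hb => ?_
      obtain ⟨-, -, w, hw, hws, rfl⟩ := hrest a ha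
      obtain ⟨-, -, w', hw', hws', rfl⟩ := hrest b hb
      rw [heq w (hL.1 hw) w' (hL.1 hw') (hws.trans hws'.symm)]
    have hAne : A.Nonempty := by
      rw [← Finset.card_pos]
      exact lt_of_lt_of_le (Finset.card_pos.2 ⟨z, hz⟩) hcard
    obtain ⟨m, hm, hmmax⟩ := Finset.exists_max_image A (fun x => x i) hAne
    have hsub : insert (m + Pi.single i 1) (A.image fun x => x + Pi.single j 1) ⊆
        shadow k {i, j} A := by
      refine Finset.insert_subset (hmem m hm i (by simp) ?_) fun x hx => ?_
      · have := hs m (hA hm)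
        omega
      · obtain ⟨w, hw, rfl⟩ := Finset.mem_image.1 hx
        refine hmem w hw j (by simp) ?_
        have := hs w (hA hw)
        omega
    have h2 := Finset.card_le_card hsub
    rw [Finset.card_insert_of_notMem, Finset.card_image_of_injective _ (add_single_injective j)]
      at h2
    · omega
    · intro h
      obtain ⟨w, hw, hwm⟩ := Finset.mem_image.1 h
      have e := congrFun hwm i
      rw [add_single_self, add_single_ne _ hij.ne] at e
      have := hmmax w hw
      omega
  · have h1 : shadow k {i} (L.filter fun x => x j = 0) = ∅ := by
      refine Finset.eq_empty_of_forall_notMem fun v hv => ?_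
      obtain ⟨h2, h3, -⟩ := hrest v hv
      omega
    rw [h1, Finset.card_empty] at hLs
    refine le_trans (by omega : _ ≤ A.card) ?_
    refine Finset.card_le_card_of_injOn
      (fun x => if x i < z i then x + Pi.single i 1 else x + Pi.single j 1) (fun x hx => ?_) ?_
    · have hxz : x i ≠ z i := fun h => hzA (heq x (hA hx) z (hL.1 hz) h ▸ hx)
      have h1 := hs x (hA hx)
      have h2 := hs z (hL.1 hz)
      have h3 := hbox z (hL.1 hz)
      simp only [Finset.mem_coe]
      split_ifs with hlt
      · exact hmem x hx i (by simp) (by omega)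
      · exact hmem x hx j (by simp) (by omega)
    · intro x hx y hy hxy
      have hxz : x i ≠ z i := fun h => hzA (heq x (hA hx) z (hL.1 hz) h ▸ hx)
      have hyz : y i ≠ z i := fun h => hzA (heq y (hA hy) z (hL.1 hz) h ▸ hy)
      refine heq x (hA hx) y (hA hy) ?_
      have e := congrFun hxy i
      by_cases h1 : x i < z i <;> by_cases h2 : y i < z i <;>
        simp only [h1, h2, if_true, if_false, add_single_self, add_single_ne _ hij.ne] at e <;>
        omega

/-- The Clements–Lindström theorem. -/
theorem card_shadow_le (hk : Monotone k) : ∀ (N : ℕ) (F : Finset (Fin n)), F.card = N →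
    ∀ c d A L, A ⊆ level k F c d → IsSeg k F c d L → L.card ≤ A.card →
      (shadow k F L).card ≤ (shadow k F A).card := by
  intro N
  induction N with
  | zero =>
    intro F hF c d A L _ _ _
    rw [Finset.card_eq_zero] at hF
    subst hF
    simp [shadow]
  | succ N ih =>
    intro F hF c d A L hA hL hcard
    have hF' : ∀ i ∈ F, (F.erase i).card = N := fun i hi => by
      rw [Finset.card_erase_of_mem hi, hF]
      rfl
    rcases L.eq_empty_or_nonempty with rfl | ⟨x, hx⟩
    · simp [shadow]
    have hAne : A.Nonempty := by
      rw [← Finset.card_pos]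
      exact lt_of_lt_of_le (Finset.card_pos.2 ⟨x, hx⟩) hcard
    rcases lt_trichotomy (N + 1) 2 with hN | hN | hN
    · obtain ⟨p, rfl⟩ := Finset.card_eq_one.1 (show F.card = 1 by omega)
      have heq : ∀ y ∈ level k {p} c d, ∀ z ∈ level k {p} c d, y = z := by
        intro y hy z hz
        by_contra hne
        obtain ⟨q, hq⟩ := Function.ne_iff.1 hne
        have hqF := mem_of_ne hy hz hq
        have := sum_free_eq hy hz
        rw [Finset.sum_singleton, Finset.sum_singleton] at this
        rw [Finset.mem_singleton.1 hqF] at hq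
        exact hq this
      obtain ⟨a, ha⟩ := hAne
      refine Finset.card_le_card (shadow_mono fun y hy => ?_)
      rw [heq y (hL.1 hy) a (hA ha)]
      exact ha
    · obtain ⟨i, j, hij, rfl⟩ := Finset.card_eq_two.1 (hF.trans hN)
      rcases lt_or_gt_of_ne hij with h | h
      · exact card_shadow_le_of_card_eq_two h (hk h.le) hA hL hcard
      · rw [Finset.pair_comm] at *
        exact card_shadow_le_of_card_eq_two h (hk h.le) hA hL hcard
    · obtain ⟨W, hW, hWc, hWs, hseg⟩ := exists_compressed (fun i hi => ih _ (hF' i hi)) hA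
      have hst := isStable_of_compressed (by omega) hW hseg
      obtain ⟨l, hl, hmax⟩ := Finset.exists_max_image F id (Finset.card_pos.1 (by omega))
      have hkl : 0 < k l := (Nat.zero_le _).trans_lt ((mem_level.1 (hL.1 hx)).1 l hl)
      have hcnt := card_filter_lt_le hW hst hl hmax (hseg l hl) hL (hcard.trans hWc.ge)
      refine le_trans ?_ hWs
      rw [hL.isStable.card_shadow hL.1 hl hmax hkl, hst.card_shadow hW hl hmax hkl]
      refine add_le_add (hcnt _) (ih _ (hF' l hl) _ _ _ _ (hseg l hl 0 hkl).1 (hL.filter hl hkl) ?_)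
      simpa only [Nat.lt_one_iff] using hcnt 1

end ClementsLindstrom

/-- A monomial order, as a relation on exponent vectors. -/
structure IsMonOrder {n : ℕ} (le : (Fin n →₀ ℕ) → (Fin n →₀ ℕ) → Prop) : Prop where
  total : ∀ m m', le m m' ∨ le m' m
  antisymm : ∀ m m', le m m' → le m' m → m = m'
  trans : ∀ m₁ m₂ m₃, le m₁ m₂ → le m₂ m₃ → le m₁ m₃
  add : ∀ m m' p, le m m' → le (m + p) (m' + p)
  zero_le : ∀ m, le 0 m

/-- The exponents of the initial monomials of the elements of `V`. -/
def leadSet {K : Type*} [Field K] {n : ℕ} (le : (Fin n →₀ ℕ) → (Fin n →₀ ℕ) → Prop)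
    (V : Submodule K (MvPolynomial (Fin n) K)) : Set (Fin n →₀ ℕ) :=
  {m | ∃ p ∈ V, IsInitialExp le p m}

section InitialExp

variable {K : Type*} [Field K] {n : ℕ} {le : (Fin n →₀ ℕ) → (Fin n →₀ ℕ) → Prop}

lemma IsMonOrder.refl (hle : IsMonOrder le) (m : Fin n →₀ ℕ) : le m m :=
  (hle.total m m).elim id id

lemma IsMonOrder.exists_max (hle : IsMonOrder le) (D : Finset (Fin n →₀ ℕ)) (hD : D.Nonempty) :
    ∃ m ∈ D, ∀ m' ∈ D, le m' m := by
  induction D using Finset.induction_on with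
  | empty => exact absurd hD (by simp)
  | insert x D _ ih =>
    rcases D.eq_empty_or_nonempty with rfl | hne
    · exact ⟨x, by simp, by simpa using hle.refl x⟩
    · obtain ⟨m, hm, hmax⟩ := ih hne
      rcases hle.total x m with h | h
      · exact ⟨m, by simp [hm], fun m' hm' => by
          rcases Finset.mem_insert.1 hm' with rfl | hm'
          exacts [h, hmax m' hm']⟩
      · exact ⟨x, by simp, fun m' hm' => by
          rcases Finset.mem_insert.1 hm' with rfl | hm'
          exacts [hle.refl _, hle.trans _ _ _ (hmax m' hm') h]⟩

lemma IsMonOrder.exists_isInitialExp (hle : IsMonOrder le) {p : MvPolynomial (Fin n) K}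
    (hp : p ≠ 0) : ∃ m, IsInitialExp le p m :=
  hle.exists_max p.support (support_nonempty.2 hp)

lemma IsMonOrder.le_of_add_le_add (hle : IsMonOrder le) {m m' p : Fin n →₀ ℕ}
    (h : le (m + p) (m' + p)) : le m m' := by
  rcases hle.total m m' with h' | h'
  · exact h'
  · have := hle.antisymm _ _ h (hle.add _ _ p h')
    rw [add_right_cancel this]
    exact hle.refl _

lemma IsMonOrder.le_of_le (hle : IsMonOrder le) {m m' : Fin n →₀ ℕ} (h : m ≤ m') :
    le m m' := by
  have := hle.add 0 (m' - m) m (hle.zero_le _)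
  rwa [zero_add, tsub_add_cancel_of_le h] at this

lemma IsMonOrder.add_le_add (hle : IsMonOrder le) {m m' p p' : Fin n →₀ ℕ}
    (h : le m m') (h' : le p p') : le (m + p) (m' + p') := by
  refine hle.trans _ _ _ (hle.add _ _ p h) ?_
  rw [add_comm m' p, add_comm m' p']
  exact hle.add _ _ _ h'

lemma IsInitialExp.mul (hle : IsMonOrder le) {p q : MvPolynomial (Fin n) K} {m m' : Fin n →₀ ℕ}
    (hp : IsInitialExp le p m) (hq : IsInitialExp le q m') : IsInitialExp le (p * q) (m + m') := by
  classical
  constructor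
  · rw [mem_support_iff, coeff_mul, Finset.sum_eq_single (m, m')]
    · exact mul_ne_zero (mem_support_iff.1 hp.1) (mem_support_iff.1 hq.1)
    · rintro ⟨u, v⟩ huv hne
      rw [Finset.HasAntidiagonal.mem_antidiagonal] at huv
      dsimp only at huv ⊢
      by_contra h0
      have hu := hp.2 u (mem_support_iff.2 (left_ne_zero_of_mul h0))
      have hv := hq.2 v (mem_support_iff.2 (right_ne_zero_of_mul h0))
      have h1 : le m u := by
        refine hle.le_of_add_le_add (p := v) ?_
        rw [huv]
        exact hle.add_le_add (hle.refl m) hv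
      have h2 : u = m := hle.antisymm _ _ hu h1
      subst h2
      exact hne (by rw [add_left_cancel huv])
    · intro h
      simp at h
  · intro w hw
    obtain ⟨u, hu, v, hv, rfl⟩ := Finset.mem_add.1 (support_mul p q hw)
    exact hle.add_le_add (hp.2 u hu) (hq.2 v hv)

lemma isInitialExp_monomial (hle : IsMonOrder le) (m : Fin n →₀ ℕ) {c : K} (hc : c ≠ 0) :
    IsInitialExp le (monomial m c) m := by
  classical
  refine ⟨by simp [hc], fun m' hm' => ?_⟩
  rw [Finset.mem_singleton.1 (support_monomial_subset hm')]
  exact hle.refl m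

lemma IsInitialExp.pow (hle : IsMonOrder le) {p : MvPolynomial (Fin n) K} {m : Fin n →₀ ℕ}
    (hp : IsInitialExp le p m) (e : ℕ) : IsInitialExp le (p ^ e) (e • m) := by
  induction e with
  | zero => simpa using isInitialExp_monomial (K := K) hle 0 one_ne_zero
  | succ e ih =>
    rw [pow_succ, succ_nsmul]
    exact ih.mul hle hp

lemma IsInitialExp.prod (hle : IsMonOrder le) {ι : Type*} (s : Finset ι)
    {p : ι → MvPolynomial (Fin n) K} {m : ι → Fin n →₀ ℕ}
    (hp : ∀ j ∈ s, IsInitialExp le (p j) (m j)) :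
    IsInitialExp le (∏ j ∈ s, p j) (∑ j ∈ s, m j) := by
  classical
  induction s using Finset.induction_on with
  | empty => simpa using isInitialExp_monomial (K := K) hle 0 one_ne_zero
  | insert x s hx ih =>
    rw [Finset.prod_insert hx, Finset.sum_insert hx]
    exact (hp x (Finset.mem_insert_self _ _)).mul hle
      (ih fun j hj => hp j (Finset.mem_insert_of_mem hj))

lemma IsInitialExp.unique (hle : IsMonOrder le) {p : MvPolynomial (Fin n) K} {m m' : Fin n →₀ ℕ}
    (h : IsInitialExp le p m) (h' : IsInitialExp le p m') : m = m' :=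
  hle.antisymm _ _ (h'.2 _ h.1) (h.2 _ h'.1)

lemma finiteDimensional_of_support_subset (D : Finset (Fin n →₀ ℕ))
    {V : Submodule K (MvPolynomial (Fin n) K)} (hV : ∀ p ∈ V, p.support ⊆ D) :
    FiniteDimensional K V := by
  have : Module.Finite K (restrictSupport K (D : Set (Fin n →₀ ℕ))) :=
    Module.Finite.of_basis (basisRestrictSupport K (D : Set (Fin n →₀ ℕ)))
  have hle : V ≤ restrictSupport K (D : Set (Fin n →₀ ℕ)) := fun p hp =>
    (mem_restrictSupport_iff K).2 (Finset.coe_subset.2 (hV p hp))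
  exact Submodule.finiteDimensional_of_le hle

/-- The dimension of a space of polynomials is the number of its initial monomials. -/
lemma finrank_eq_ncard_leadSet (hle : IsMonOrder le) (D : Finset (Fin n →₀ ℕ)) :
    ∀ V : Submodule K (MvPolynomial (Fin n) K), (∀ p ∈ V, p.support ⊆ D) →
      Module.finrank K V = (leadSet le V).ncard := by
  classical
  induction hN : D.card generalizing D with
  | zero =>
    intro V hV
    rw [Finset.card_eq_zero] at hN
    subst hN
    have hV0 : V = ⊥ := (Submodule.eq_bot_iff _).2 fun p hp =>
      support_eq_empty.1 (Finset.subset_empty.1 (hV p hp))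
    have : leadSet le V = ∅ := Set.eq_empty_of_forall_notMem fun m ⟨p, hp, hm⟩ => by
      simpa using hV p hp hm.1
    rw [this, hV0]
    simp
  | succ N ih =>
    intro V hV
    obtain ⟨m, hm, hmax⟩ := hle.exists_max D (Finset.card_pos.1 (by omega))
    have hfin : FiniteDimensional K V := finiteDimensional_of_support_subset D hV
    let V' := V ⊓ LinearMap.ker (lcoeff K m)
    have hmem' : ∀ p, p ∈ V' ↔ p ∈ V ∧ coeff m p = 0 := fun p => Iff.rfl
    have hV' : Module.finrank K V' = (leadSet le V').ncard := by
      refine ih (D.erase m) (by rw [Finset.card_erase_of_mem hm, hN]; rfl) V' fun p hp u hu => ?_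
      rw [hmem'] at hp
      refine Finset.mem_erase.2 ⟨?_, hV p hp.1 hu⟩
      rintro rfl
      exact mem_support_iff.1 hu hp.2
    have hrank := LinearMap.finrank_range_add_finrank_ker ((lcoeff K m).domRestrict V)
    have hker : Module.finrank K (LinearMap.ker ((lcoeff K m).domRestrict V)) =
        Module.finrank K V' := by
      rw [← Submodule.finrank_map_subtype_eq V, LinearMap.domRestrict, LinearMap.ker_comp,
        Submodule.map_comap_subtype]
    have hfinset : (leadSet le V').Finite :=
      D.finite_toSet.subset fun u ⟨p, hp, hu⟩ => hV p hp.1 hu.1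
    have hmV' : m ∉ leadSet le V' := fun ⟨p, hp, hu⟩ =>
      mem_support_iff.1 hu.1 hp.2
    rw [hker, hV'] at hrank
    rw [← hrank]
    by_cases h : ∃ p ∈ V, coeff m p ≠ 0
    · obtain ⟨p, hp, hpm⟩ := h
      have hr : LinearMap.range ((lcoeff K m).domRestrict V) = ⊤ :=
        LinearMap.range_eq_top.2 (LinearMap.surjective fun h0 =>
          hpm (LinearMap.congr_fun h0 (⟨p, hp⟩ : V)))
      have hl : leadSet le V = insert m (leadSet le V') := by
        ext u
        constructor
        · rintro ⟨q, hq, hu⟩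
          by_cases hqm : coeff m q = 0
          · exact Or.inr ⟨q, ⟨hq, hqm⟩, hu⟩
          · exact Or.inl (hle.antisymm _ _ (hmax u (hV q hq hu.1))
              (hu.2 m (mem_support_iff.2 hqm)))
        · rintro (rfl | ⟨q, hq, hu⟩)
          · exact ⟨p, hp, mem_support_iff.2 hpm, fun m' hm' => hmax m' (hV p hp hm')⟩
          · exact ⟨q, hq.1, hu⟩
      rw [hr, hl, Set.ncard_insert_of_notMem hmV' hfinset, finrank_top, Module.finrank_self,
        add_comm]
    · push Not at h
      have hr : LinearMap.range ((lcoeff K m).domRestrict V) = ⊥ := by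
        rw [LinearMap.range_eq_bot]
        ext ⟨p, hp⟩
        exact h p hp
      have hl : V' = V := inf_eq_left.2 fun p hp => h p hp
      rw [hr, hl, finrank_bot, zero_add]

lemma mem_homogeneousSubmodule_iff {p : MvPolynomial (Fin n) K} {d : ℕ} :
    p ∈ homogeneousSubmodule (Fin n) K d ↔ ∀ m ∈ p.support, expDeg m = d := by
  rw [mem_homogeneousSubmodule]
  refine forall_congr' fun m => ?_
  rw [mem_support_iff, expDeg, ← Finsupp.degree_eq_sum, Finsupp.degree_eq_weight_one (R := ℕ)]
  rfl

lemma mem_component {I : Ideal (MvPolynomial (Fin n) K)} {p : MvPolynomial (Fin n) K} {d : ℕ} :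
    p ∈ component I d ↔ p ∈ I ∧ ∀ m ∈ p.support, expDeg m = d :=
  and_congr_right fun _ => mem_homogeneousSubmodule_iff

lemma expDeg_add (m m' : Fin n →₀ ℕ) : expDeg (m + m') = expDeg m + expDeg m' := by
  simp [expDeg, Finset.sum_add_distrib]

lemma expDeg_single (i : Fin n) (e : ℕ) : expDeg (Finsupp.single i e) = e := by
  simp [expDeg, Finsupp.single_apply]

lemma finite_expDeg_eq (d : ℕ) : {m : Fin n →₀ ℕ | expDeg m = d}.Finite := by
  have := Finset.finite_toSet (Finset.finsuppAntidiag (Finset.univ : Finset (Fin n)) d)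
  refine this.subset fun m hm => ?_
  simpa [expDeg] using hm

lemma hilb_eq_ncard (hle : IsMonOrder le) (I : Ideal (MvPolynomial (Fin n) K)) (d : ℕ) :
    hilb I d = (leadSet le (component I d)).ncard :=
  finrank_eq_ncard_leadSet hle (finite_expDeg_eq d).toFinset _ fun p hp m hm => by
    simpa using (mem_component.1 hp).2 m hm

/-- The exponents of the initial monomials of the homogeneous elements of `I`. -/
def initialExps (le : (Fin n →₀ ℕ) → (Fin n →₀ ℕ) → Prop)
    (I : Ideal (MvPolynomial (Fin n) K)) : Set (Fin n →₀ ℕ) :=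
  {m | m ∈ leadSet le (component I (expDeg m))}

lemma hilb_eq_ncard_initialExps (hle : IsMonOrder le) (I : Ideal (MvPolynomial (Fin n) K))
    (d : ℕ) : hilb I d = {m ∈ initialExps le I | expDeg m = d}.ncard := by
  rw [hilb_eq_ncard hle]
  congr 1
  ext m
  constructor
  · rintro ⟨p, hp, hm⟩
    have hd := (mem_component.1 hp).2 m hm.1
    exact ⟨⟨p, hd.symm ▸ hp, hm⟩, hd⟩
  · rintro ⟨hm, rfl⟩
    exact hm

lemma isUpperSet_initialExps (hle : IsMonOrder le) (I : Ideal (MvPolynomial (Fin n) K)) :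
    IsUpperSet (initialExps le I) := by
  rintro m m' hmm' ⟨p, hp, hm⟩
  obtain ⟨u, rfl⟩ := exists_add_of_le hmm'
  rw [mem_component] at hp
  have h := hm.mul hle (isInitialExp_monomial (K := K) hle u one_ne_zero)
  refine ⟨p * monomial u 1, mem_component.2 ⟨I.mul_mem_right _ hp.1, fun w hw => ?_⟩, h⟩
  classical
  obtain ⟨v, hv, v', hv', rfl⟩ := Finset.mem_add.1 (support_mul _ _ hw)
  rw [Finset.mem_singleton.1 (support_monomial_subset hv'), expDeg_add, expDeg_add, hp.2 v hv]

lemma mem_span_monomial_iff {T : Set (Fin n →₀ ℕ)} (hT : IsUpperSet T)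
    {p : MvPolynomial (Fin n) K} :
    p ∈ Ideal.span ((fun m => (monomial m (1 : K) : MvPolynomial (Fin n) K)) '' T) ↔
      ∀ m ∈ p.support, m ∈ T := by
  rw [mem_ideal_span_monomial_image]
  exact forall₂_congr fun m _ => ⟨fun ⟨u, hu, hle⟩ => hT hle hu, fun h => ⟨m, h, le_rfl⟩⟩

lemma initialExps_span_monomial (hle : IsMonOrder le) {T : Set (Fin n →₀ ℕ)}
    (hT : IsUpperSet T) :
    initialExps le
      (Ideal.span ((fun m => (monomial m (1 : K) : MvPolynomial (Fin n) K)) '' T)) = T := by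
  ext m
  constructor
  · rintro ⟨p, hp, hm⟩
    exact (mem_span_monomial_iff hT).1 (mem_component.1 hp).1 m hm.1
  · intro hm
    have h := isInitialExp_monomial (K := K) hle m one_ne_zero
    have hs : ∀ u ∈ (monomial m (1 : K)).support, u = m := fun u hu =>
      Finset.mem_singleton.1 (support_monomial_subset hu)
    exact ⟨monomial m 1, mem_component.2 ⟨Ideal.subset_span ⟨m, hm, rfl⟩, fun u hu => by
      rw [hs u hu]⟩, h⟩

end InitialExp

section LexPlusPowers

open ClementsLindstrom

variable {K : Type*} [Field K] {n r : ℕ}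

lemma lexLe_iff {m m' : Fin n →₀ ℕ} : lexLe m m' ↔ toLex (⇑m) ≤ toLex (⇑m') := by
  rw [le_iff_eq_or_lt, lexLe]
  refine or_congr ⟨fun h => by rw [h], fun h => DFunLike.coe_injective (toLex.injective h)⟩ ?_
  constructor
  · rintro ⟨i, hlt, hi⟩
    exact ⟨i, hlt, hi⟩
  · intro h
    obtain ⟨i, hlt, hi⟩ := h
    exact ⟨i, hlt, hi⟩

lemma isMonOrder_lexLe : IsMonOrder (lexLe (n := n)) where
  total m m' := by simpa only [lexLe_iff] using le_total _ _
  antisymm m m' h h' := by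
    rw [lexLe_iff] at h h'
    exact DFunLike.coe_injective (toLex.injective (le_antisymm h h'))
  trans m₁ m₂ m₃ h h' := by
    rw [lexLe_iff] at h h' ⊢
    exact h.trans h'
  add m m' p h := by
    rcases h with rfl | ⟨i, hlt, hi⟩
    · exact Or.inl rfl
    · exact Or.inr ⟨i, fun j hj => by simp [hlt j hj], by simpa using hi⟩
  zero_le m := by
    rw [lexLe_iff]
    exact Pi.toLex_monotone fun i => Nat.zero_le (m i)

/-- The exponents of the monomials of the pure-powers ideal. -/
def powerExps (hrn : r ≤ n) (a : Fin r → ℕ) : Set (Fin n →₀ ℕ) :=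
  {m | ∃ i, a i ≤ m (Fin.castLE hrn i)}

lemma isUpperSet_powerExps (hrn : r ≤ n) (a : Fin r → ℕ) : IsUpperSet (powerExps hrn a) :=
  fun _ _ h ⟨i, hi⟩ => ⟨i, hi.trans (h _)⟩

lemma mem_purePowers {hrn : r ≤ n} {a : Fin r → ℕ} {p : MvPolynomial (Fin n) K} :
    p ∈ purePowers K hrn a ↔ ∀ m ∈ p.support, m ∈ powerExps hrn a := by
  have : (Set.range fun i : Fin r => (X (Fin.castLE hrn i) ^ a i : MvPolynomial (Fin n) K)) =
      (fun m => monomial m (1 : K)) '' Set.range fun i => Finsupp.single (Fin.castLE hrn i) (a i) := by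
    rw [← Set.range_comp]
    exact congrArg Set.range (funext fun i => X_pow_eq_monomial)
  rw [purePowers, this, mem_ideal_span_monomial_image]
  simp [powerExps]

lemma isUpperSet_of_add_single {T : Set (Fin n →₀ ℕ)}
    (h : ∀ m ∈ T, ∀ i, m + Finsupp.single i 1 ∈ T) : IsUpperSet T := by
  intro m m' hle hm
  obtain ⟨u, rfl⟩ := exists_add_of_le hle
  clear hle
  induction u using Finsupp.induction_linear generalizing m with
  | zero => simpa using hm
  | add u v hu hv =>
    rw [← add_assoc]
    exact hv (hu hm)
  | single i e =>
    induction e with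
    | zero => simpa using hm
    | succ e ih =>
      rw [Finsupp.single_add, ← add_assoc]
      exact h _ ih i

/-- Bounds that cut out the exponents outside the pure-powers ideal in degrees below `D`. -/
def capBound (a : Fin r → ℕ) (D : ℕ) (i : Fin n) : ℕ :=
  if h : (i : ℕ) < r then min (a ⟨i, h⟩) D else D

lemma monotone_capBound {a : Fin r → ℕ} (ha : Monotone a) (D : ℕ) :
    Monotone (capBound (n := n) a D) := by
  intro i j hij
  have hij' : (i : ℕ) ≤ j := hij
  unfold capBound
  split_ifs with h1 h2 h2
  · exact min_le_min_right _ (ha hij)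
  · exact min_le_right _ _
  · omega
  · exact le_rfl

lemma mem_level_capBound {hrn : r ≤ n} {a : Fin r → ℕ} {D : ℕ} {m : Fin n →₀ ℕ}
    (hm : expDeg m < D) :
    ⇑m ∈ level (capBound a D) Finset.univ 0 (expDeg m) ↔ m ∉ powerExps hrn a := by
  have hlt : ∀ i, m i < D := fun i =>
    (Finset.single_le_sum (f := m) (fun _ _ => Nat.zero_le _) (Finset.mem_univ i)).trans_lt hm
  rw [mem_level]
  constructor
  · rintro ⟨h, -, -⟩ ⟨i, hi⟩
    have := h (Fin.castLE hrn i) (Finset.mem_univ _)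
    rw [capBound, dif_pos (show ((Fin.castLE hrn i : Fin n) : ℕ) < r from i.2)] at this
    exact absurd hi (not_le.2 (this.trans_le (min_le_left _ _)))
  · intro h
    refine ⟨fun i _ => ?_, fun i hi => absurd (Finset.mem_univ i) hi, rfl⟩
    unfold capBound
    split_ifs with hi
    · exact lt_min (not_le.1 fun h' => h ⟨⟨i, hi⟩, h'⟩) (hlt i)
    · exact hlt i

lemma ncard_expDeg_eq {hrn : r ≤ n} {a : Fin r → ℕ} {D e : ℕ} (he : e < D)
    {Q : Set (Fin n →₀ ℕ)} (hQ : powerExps hrn a ⊆ Q) {B : Finset (Fin n → ℕ)}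
    (hB : B ⊆ level (capBound a D) Finset.univ 0 e)
    (hmem : ∀ m, expDeg m = e → m ∉ powerExps hrn a → (m ∈ Q ↔ ⇑m ∈ B)) :
    {m ∈ Q | expDeg m = e}.ncard = {m ∈ powerExps hrn a | expDeg m = e}.ncard + B.card := by
  have hB' : ∀ m : Fin n →₀ ℕ, ⇑m ∈ B → expDeg m = e ∧ m ∉ powerExps hrn a := fun m hm => by
    have h := hB hm
    have hd : expDeg m = e := (mem_level.1 h).2.2
    subst hd
    exact ⟨rfl, (mem_level_capBound he).1 h⟩
  have hfin : ∀ R : Set (Fin n →₀ ℕ), {m ∈ R | expDeg m = e}.Finite := fun R =>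
    (finite_expDeg_eq e).subset fun m hm => hm.2
  have hset : {m ∈ Q | expDeg m = e} =
      {m ∈ powerExps hrn a | expDeg m = e} ∪ Finsupp.equivFunOnFinite.symm '' (B : Set _) := by
    ext m
    constructor
    · rintro ⟨hm, hd⟩
      by_cases hP : m ∈ powerExps hrn a
      · exact Or.inl ⟨hP, hd⟩
      · exact Or.inr ⟨m, (hmem m hd hP).1 hm, by simp⟩
    · rintro (hm | ⟨x, hx, rfl⟩)
      · exact ⟨hQ hm.1, hm.2⟩
      · have h := hB' (Finsupp.equivFunOnFinite.symm x) hx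
        exact ⟨(hmem _ h.1 h.2).2 hx, h.1⟩
  rw [hset, Set.ncard_union_eq _ (hfin _) (B.finite_toSet.image _),
    Set.ncard_image_of_injective _ (Equiv.injective _), Set.ncard_coe_finset]
  rw [Set.disjoint_left]
  rintro _ hm ⟨x, hx, rfl⟩
  exact (hB' (Finsupp.equivFunOnFinite.symm x) hx).2 hm.1

lemma isLPP_span_monomial {hrn : r ≤ n} {a : Fin r → ℕ} {T : Set (Fin n →₀ ℕ)}
    (hT : IsUpperSet T) (hP : powerExps hrn a ⊆ T)
    (hlex : ∀ m ∈ T, m ∉ powerExps hrn a → ∀ m', expDeg m' = expDeg m → lexLe m m' → m' ∈ T) :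
    IsLPP hrn a
      (Ideal.span ((fun m => (monomial m (1 : K) : MvPolynomial (Fin n) K)) '' T)) := by
  classical
  refine ⟨fun p hp e => ?_, fun e => ?_⟩
  · rw [mem_span_monomial_iff hT] at hp ⊢
    intro m hm
    refine hp m (mem_support_iff.2 fun h => ?_)
    rw [mem_support_iff, coeff_homogeneousComponent, h, ite_self] at hm
    exact hm rfl
  refine ⟨{m | expDeg m = e ∧ ∃ m₀ ∈ T, m₀ ∉ powerExps hrn a ∧ expDeg m₀ = e ∧ lexLe m₀ m},
    ⟨fun m hm => hm.1, ?_⟩, le_antisymm ?_ (sup_le ?_ ?_)⟩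
  · rintro m ⟨-, m₀, h₀, hp₀, hd₀, hl₀⟩ m' hm' hl
    exact ⟨hm', m₀, h₀, hp₀, hd₀, isMonOrder_lexLe.trans _ _ _ hl₀ hl⟩
  · intro p hp
    obtain ⟨hpT, hpd⟩ := mem_component.1 hp
    rw [mem_span_monomial_iff hT] at hpT
    rw [← p.support_sum_monomial_coeff]
    refine Submodule.sum_mem _ fun m hm => ?_
    by_cases hmP : m ∈ powerExps hrn a
    · refine Submodule.mem_sup_right (mem_component.2 ⟨mem_purePowers.2 fun u hu => ?_,
        fun u hu => ?_⟩)
      · rwa [Finset.mem_singleton.1 (support_monomial_subset hu)]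
      · rw [Finset.mem_singleton.1 (support_monomial_subset hu), hpd m hm]
    · refine Submodule.mem_sup_left ?_
      have : monomial m (coeff m p) = coeff m p • monomial m (1 : K) := by
        rw [smul_monomial, smul_eq_mul, mul_one]
      rw [this]
      exact Submodule.smul_mem _ _ (Submodule.subset_span
        ⟨m, ⟨hpd m hm, m, hpT m hm, hmP, hpd m hm, Or.inl rfl⟩, rfl⟩)
  · rw [Submodule.span_le]
    rintro _ ⟨m, ⟨hd, m₀, h₀, hp₀, hd₀, hl₀⟩, rfl⟩
    refine mem_component.2 ⟨Ideal.subset_span ⟨m, hlex m₀ h₀ hp₀ m (hd.trans hd₀.symm) hl₀, rfl⟩,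
      fun u hu => ?_⟩
    rw [Finset.mem_singleton.1 (support_monomial_subset hu), hd]
  · intro p hp
    rw [mem_component, mem_purePowers] at hp
    rw [mem_component, mem_span_monomial_iff hT]
    exact ⟨fun m hm => hP (hp.1 m hm), hp.2⟩

/-- An ideal whose Hilbert function counts an upper set of exponents that contains the
pure-powers ideal satisfies `EGH`. -/
lemma egh_of_hilb_eq_ncard {hrn : r ≤ n} {a : Fin r → ℕ} (ha : Monotone a)
    {I : Ideal (MvPolynomial (Fin n) K)} {U : Set (Fin n →₀ ℕ)} (hU : IsUpperSet U)
    (hPU : powerExps hrn a ⊆ U) (hI : ∀ d, hilb I d = {m ∈ U | expDeg m = d}.ncard) :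
    EGH hrn a I := by
  classical
  intro d
  set k := capBound (n := n) a (d + 2)
  let B : ℕ → Finset (Fin n → ℕ) := fun e =>
    (level k Finset.univ 0 e).filter fun x => Finsupp.equivFunOnFinite.symm x ∈ U
  have hB : ∀ e, B e ⊆ level k Finset.univ 0 e := fun e => Finset.filter_subset _ _
  have hBmem : ∀ e < d + 2, ∀ m, expDeg m = e → m ∉ powerExps hrn a → (m ∈ U ↔ ⇑m ∈ B e) := by
    rintro e he m rfl hm
    rw [Finset.mem_filter, mem_level_capBound (hrn := hrn) he,
      Finsupp.equivFunOnFinite_symm_coe]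
    exact ⟨fun h => ⟨hm, h⟩, fun h => h.2⟩
  have hshadowB : shadow k Finset.univ (B d) ⊆ B (d + 1) := by
    intro x hx
    refine Finset.mem_filter.2 ⟨shadow_subset_level (hB d) hx, ?_⟩
    obtain ⟨-, w, hw, i, -, rfl⟩ := mem_shadow.1 hx
    refine hU (fun j => ?_) (Finset.mem_filter.1 hw).2
    exact le_add_single w i j
  obtain ⟨L, hL, hLcard⟩ := exists_seg (B d).card (Finset.card_le_card (hB d))
  have hL' := hL.shadow
  let T : Set (Fin n →₀ ℕ) := {m | m ∈ powerExps hrn a ∨ (expDeg m = d ∧ ⇑m ∈ L) ∨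
    (expDeg m = d + 1 ∧ ⇑m ∈ shadow k Finset.univ L) ∨ d + 2 ≤ expDeg m}
  have hPT : powerExps hrn a ⊆ T := fun m hm => Or.inl hm
  have hT : IsUpperSet T := by
    refine isUpperSet_of_add_single fun m hm i => ?_
    have hdeg : expDeg (m + Finsupp.single i 1) = expDeg m + 1 := by
      rw [expDeg_add, expDeg_single]
    by_cases hP : m + Finsupp.single i 1 ∈ powerExps hrn a
    · exact Or.inl hP
    rcases hm with hm | ⟨hd, hm⟩ | ⟨hd, -⟩ | hd
    · exact absurd (isUpperSet_powerExps hrn a le_self_add hm) hP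
    · refine Or.inr (Or.inr (Or.inl ⟨by rw [hdeg, hd], mem_shadow.2 ⟨?_, m, hm, i,
        Finset.mem_univ _, by rw [Finsupp.coe_add, Finsupp.single_eq_pi_single]⟩⟩))
      exact (mem_level.1 ((mem_level_capBound (by omega)).2 hP)).1
    · exact Or.inr (Or.inr (Or.inr (by omega)))
    · exact Or.inr (Or.inr (Or.inr (by omega)))
  have hlex : ∀ m ∈ T, m ∉ powerExps hrn a → ∀ m', expDeg m' = expDeg m → lexLe m m' →
      m' ∈ T := by
    intro m hm hP m' hd' hl
    by_cases hP' : m' ∈ powerExps hrn a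
    · exact Or.inl hP'
    rw [lexLe_iff] at hl
    rcases hm with hm | ⟨hd, hm⟩ | ⟨hd, hm⟩ | hd
    · exact absurd hm hP
    · have hlev := (mem_level_capBound (D := d + 2) (by omega)).2 hP'
      rw [hd', hd] at hlev
      exact Or.inr (Or.inl ⟨hd'.trans hd, hL.2 _ hm _ hlev hl⟩)
    · have hlev := (mem_level_capBound (D := d + 2) (by omega)).2 hP'
      rw [hd', hd] at hlev
      exact Or.inr (Or.inr (Or.inl ⟨hd'.trans hd, hL'.2 _ hm _ hlev hl⟩))
    · exact Or.inr (Or.inr (Or.inr (hd'.symm ▸ hd)))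
  refine ⟨_, isLPP_span_monomial (K := K) hT hPT hlex, ?_, ?_⟩
  · rw [hilb_eq_ncard_initialExps isMonOrder_lexLe, initialExps_span_monomial isMonOrder_lexLe hT,
      hI, ncard_expDeg_eq (D := d + 2) (by omega) hPU (hB d) (hBmem d (by omega)), ← hLcard]
    refine ncard_expDeg_eq (D := d + 2) (by omega) hPT hL.1 fun m hd hP => ⟨?_, fun h => ?_⟩
    · rintro (h | ⟨-, h⟩ | ⟨h, -⟩ | h)
      exacts [absurd h hP, h, by omega, by omega]
    · exact Or.inr (Or.inl ⟨hd, h⟩)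
  · rw [hilb_eq_ncard_initialExps isMonOrder_lexLe, initialExps_span_monomial isMonOrder_lexLe hT,
      hI, ncard_expDeg_eq (D := d + 2) (by omega) hPU (hB (d + 1)) (hBmem (d + 1) (by omega)),
      ncard_expDeg_eq (D := d + 2) (by omega) hPT hL'.1]
    · exact Nat.add_le_add_left ((card_shadow_le (monotone_capBound ha _) _ _ rfl _ _ _ _ (hB d) hL
        hLcard.le).trans (Finset.card_le_card hshadowB)) _
    · refine fun m hd hP => ⟨?_, fun h => ?_⟩
      · rintro (h | ⟨h, -⟩ | ⟨-, h⟩ | h)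
        exacts [absurd h hP, by omega, h, by omega]
      · exact Or.inr (Or.inr (Or.inl ⟨hd, h⟩))

end LexPlusPowers

section Groebner

variable {K : Type*} [Field K] {n r : ℕ} {le : (Fin n →₀ ℕ) → (Fin n →₀ ℕ) → Prop}

lemma IsMonOrder.wellFounded (hle : IsMonOrder le) :
    WellFounded fun m m' => le m m' ∧ ¬ le m' m := by
  have : IsPreorder _ le := { refl := hle.refl, trans := hle.trans }
  refine WellQuasiOrdered.wellFounded fun s => ?_
  obtain ⟨i, j, hij, h⟩ := wellQuasiOrdered_le s
  exact ⟨i, j, hij, hle.le_of_le h⟩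

lemma exists_le_of_initialIdeal_eq {F : Ideal (MvPolynomial (Fin n) K)}
    {f : Fin r → MvPolynomial (Fin n) K} (hle : IsMonOrder le)
    {μ : Fin r → Fin n →₀ ℕ} (hμ : ∀ i, IsInitialExp le (f i) (μ i))
    (hGB : initialIdeal le F =
      Ideal.span { q | ∃ (i : Fin r) (mm : Fin n →₀ ℕ), IsInitialExp le (f i) mm ∧
        q = (monomial mm (1 : K) : MvPolynomial (Fin n) K) })
    {p : MvPolynomial (Fin n) K} (hp : p ∈ F) {u : Fin n →₀ ℕ} (hu : IsInitialExp le p u) :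
    ∃ i, μ i ≤ u := by
  have h : monomial u (1 : K) ∈ initialIdeal le F := Ideal.subset_span ⟨p, hp, u, hu, rfl⟩
  have hset : { q | ∃ (i : Fin r) (mm : Fin n →₀ ℕ), IsInitialExp le (f i) mm ∧
        q = (monomial mm (1 : K) : MvPolynomial (Fin n) K) } =
      (fun m => monomial m (1 : K)) '' Set.range μ := by
    ext q
    constructor
    · rintro ⟨i, mm, hmm, rfl⟩
      exact ⟨mm, ⟨i, (hμ i).unique hle hmm⟩, rfl⟩
    · rintro ⟨_, ⟨i, rfl⟩, rfl⟩
      exact ⟨i, μ i, hμ i, rfl⟩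
  rw [hGB, hset, mem_ideal_span_monomial_image] at h
  obtain ⟨_, ⟨i, rfl⟩, hi⟩ := h u (by simp)
  exact ⟨i, hi⟩

/-- Division by a Gröbner basis: an element of the ideal is a combination of the basis
without cancellation of leading terms. -/
lemma exists_sum_mul_eq (hle : IsMonOrder le) {f : Fin r → MvPolynomial (Fin n) K}
    {μ : Fin r → Fin n →₀ ℕ} (hμ : ∀ i, IsInitialExp le (f i) (μ i))
    (hG : ∀ p ∈ Ideal.span (Set.range f), ∀ u, IsInitialExp le p u → ∃ i, μ i ≤ u)
    (u : Fin n →₀ ℕ) : ∀ p ∈ Ideal.span (Set.range f), IsInitialExp le p u →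
      ∃ h : Fin r → MvPolynomial (Fin n) K, p = ∑ i, h i * f i ∧
        ∀ i, ∀ w ∈ (h i).support, le (w + μ i) u := by
  classical
  induction u using hle.wellFounded.induction with
  | _ u ih =>
  intro p hp hu
  obtain ⟨k, hk⟩ := hG p hp u hu
  obtain ⟨v, rfl⟩ := exists_add_of_le hk
  have hck : coeff (μ k) (f k) ≠ 0 := mem_support_iff.1 (hμ k).1
  have hcp : coeff (μ k + v) p ≠ 0 := mem_support_iff.1 hu.1
  set c := coeff (μ k + v) p / coeff (μ k) (f k) with hc
  have hv := (hμ k).mul hle (isInitialExp_monomial hle v (div_ne_zero hcp hck))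
  set q := p - f k * monomial v c with hq
  have hqF : q ∈ Ideal.span (Set.range f) :=
    Ideal.sub_mem _ hp (Ideal.mul_mem_right _ _ (Ideal.subset_span ⟨k, rfl⟩))
  have hmon : ∀ w ∈ (monomial v c).support, le (w + μ k) (μ k + v) := fun w hw => by
    rw [Finset.mem_singleton.1 (support_monomial_subset hw), add_comm]
    exact hle.refl _
  have hqs : ∀ w ∈ q.support, le w (μ k + v) := fun w hw =>
    (Finset.mem_union.1 (support_sub _ _ _ hw)).elim (hu.2 w) (hv.2 w)
  have hq0 : coeff (μ k + v) q = 0 := by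
    rw [hq, coeff_sub, coeff_mul_monomial, hc, mul_div_cancel₀ _ hck, sub_self]
  have key : ∀ h : Fin r → MvPolynomial (Fin n) K, q = ∑ i, h i * f i →
      p = ∑ i, (h + Pi.single k (monomial v c) : Fin r → MvPolynomial (Fin n) K) i * f i := fun h hh => by
    simp only [Pi.add_apply, add_mul, Finset.sum_add_distrib, ← hh, Pi.single_apply, ite_mul,
      zero_mul, Finset.sum_ite_eq', Finset.mem_univ, if_true]
    rw [hq]
    ring
  have key' : ∀ h : Fin r → MvPolynomial (Fin n) K,
      (∀ i, ∀ w ∈ (h i).support, le (w + μ i) (μ k + v)) →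
      ∀ i, ∀ w ∈ ((h + Pi.single k (monomial v c) : Fin r → MvPolynomial (Fin n) K) i).support,
        le (w + μ i) (μ k + v) := by
    intro h hh i w hw
    rcases Finset.mem_union.1 (support_add hw) with hw | hw
    · exact hh i w hw
    · by_cases hik : i = k
      · subst hik
        rw [Pi.single_eq_same] at hw
        exact hmon w hw
      · rw [Pi.single_eq_of_ne hik] at hw
        simp at hw
  by_cases hq' : q = 0
  · exact ⟨_, key 0 (by simp [hq']), key' 0 (by simp)⟩
  · obtain ⟨u', hu'⟩ := hle.exists_isInitialExp hq'
    have hlt : le u' (μ k + v) := hqs u' hu'.1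
    have hlt' : ¬ le (μ k + v) u' := fun h => by
      have := hle.antisymm _ _ hlt h
      subst this
      exact mem_support_iff.1 hu'.1 hq0
    obtain ⟨h, hh, hh'⟩ := ih u' ⟨hlt, hlt'⟩ q hqF hu'
    exact ⟨_, key h hh, key' h fun i w hw => hle.trans _ _ _ (hh' i w hw) hlt⟩

/-- The coefficients of a relation between the members of a regular sequence lie in the ideal
that the sequence generates. -/
lemma mem_span_of_sum_mul_eq_zero : ∀ {r : ℕ} (f : Fin r → MvPolynomial (Fin n) K), IsRegSeq f →
    ∀ h : Fin r → MvPolynomial (Fin n) K, ∑ i, h i * f i = 0 →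
      ∀ i, h i ∈ Ideal.span (Set.range f)
  | 0, _, _, _, _, i => i.elim0
  | r + 1, f, hf, h, hh, i => by
    have hset : {p | ∃ j : Fin (r + 1), j < Fin.last r ∧ p = f j} =
        Set.range fun j : Fin r => f j.castSucc := by
      ext p
      constructor
      · rintro ⟨j, hj, rfl⟩
        exact ⟨j.castPred hj.ne, by simp⟩
      · rintro ⟨j, rfl⟩
        exact ⟨_, j.castSucc_lt_last, rfl⟩
    have hsub : Ideal.span (Set.range fun j : Fin r => f j.castSucc) ≤
        Ideal.span (Set.range f) :=
      Ideal.span_mono (by rintro _ ⟨j, rfl⟩; exact ⟨_, rfl⟩)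
    have hreg : IsRegSeq fun j : Fin r => f j.castSucc := by
      intro j g hg
      have hset' : {p | ∃ l : Fin r, l < j ∧ p = f l.castSucc} =
          {p | ∃ l : Fin (r + 1), l < j.castSucc ∧ p = f l} := by
        ext p
        constructor
        · rintro ⟨l, hl, rfl⟩
          exact ⟨l.castSucc, hl, rfl⟩
        · rintro ⟨l, hl, rfl⟩
          exact ⟨l.castPred (hl.trans j.castSucc_lt_last).ne, hl, by simp⟩
      rw [hset'] at hg ⊢
      exact hf _ g hg
    rw [Fin.sum_univ_castSucc] at hh
    have hlast : h (Fin.last r) ∈ Ideal.span (Set.range fun j : Fin r => f j.castSucc) := by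
      rw [← hset]
      refine hf _ _ ?_
      rw [hset, eq_neg_of_add_eq_zero_right hh]
      exact neg_mem (Ideal.sum_mem _ fun j _ => Ideal.mul_mem_left _ _ (Ideal.subset_span ⟨j, rfl⟩))
    obtain ⟨c, hc⟩ := Ideal.mem_span_range_iff_exists_fun.1 hlast
    induction i using Fin.lastCases with
    | last => exact hsub hlast
    | cast i =>
      have := mem_span_of_sum_mul_eq_zero _ hreg
        (fun j => h j.castSucc + c j * f (Fin.last r)) (by
          rw [← hh, ← hc, Finset.sum_mul, ← Finset.sum_add_distrib]
          exact Finset.sum_congr rfl fun j _ => by ring) i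
      have hl : c i * f (Fin.last r) ∈ Ideal.span (Set.range f) :=
        Ideal.mul_mem_left _ _ (Ideal.subset_span ⟨_, rfl⟩)
      simpa using Ideal.sub_mem _ (hsub this) hl

lemma exists_le_tsub (hle : IsMonOrder le) {f : Fin r → MvPolynomial (Fin n) K}
    (hreg : IsRegSeq f)
    {μ : Fin r → Fin n →₀ ℕ} (hμ : ∀ i, IsInitialExp le (f i) (μ i))
    (hG : ∀ p ∈ Ideal.span (Set.range f), ∀ u, IsInitialExp le p u → ∃ i, μ i ≤ u)
    {i j : Fin r} (hij : i ≠ j) : ∃ k, μ k ≤ μ j - μ i := by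
  classical
  have hsup : μ i + (μ j - μ i) = μ j + (μ i - μ j) := by
    ext x
    simp only [Finsupp.add_apply, Finsupp.tsub_apply]
    omega
  have hci : coeff (μ i) (f i) ≠ 0 := mem_support_iff.1 (hμ i).1
  have hcj : coeff (μ j) (f j) ≠ 0 := mem_support_iff.1 (hμ j).1
  set ci := coeff (μ i) (f i)
  set cj := coeff (μ j) (f j)
  set P := monomial (μ j - μ i) cj with hP
  set Q := monomial (μ i - μ j) ci with hQ
  have hi := (hμ i).mul hle (isInitialExp_monomial hle (μ j - μ i) hcj)
  have hj := (hμ j).mul hle (isInitialExp_monomial hle (μ i - μ j) hci)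
  rw [← hsup] at hj
  set s := μ i + (μ j - μ i) with hs
  set p := f i * P - f j * Q with hp
  have hpF : p ∈ Ideal.span (Set.range f) :=
    Ideal.sub_mem _ (Ideal.mul_mem_right _ _ (Ideal.subset_span ⟨i, rfl⟩))
      (Ideal.mul_mem_right _ _ (Ideal.subset_span ⟨j, rfl⟩))
  have hps : ∀ w ∈ p.support, le w s := fun w hw =>
    (Finset.mem_union.1 (support_sub _ _ _ hw)).elim (hi.2 w) (hj.2 w)
  have hp0 : coeff s p = 0 := by
    rw [hp, coeff_sub, hs, coeff_mul_monomial, ← hs, hsup, coeff_mul_monomial, mul_comm, sub_self]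
  obtain ⟨h, hh, hh'⟩ : ∃ h : Fin r → MvPolynomial (Fin n) K, p = ∑ l, h l * f l ∧
      ∀ w ∈ (h i).support, le (w + μ i) s ∧ w + μ i ≠ s := by
    by_cases hpz : p = 0
    · exact ⟨0, by simp [hpz], by simp⟩
    · obtain ⟨u, hu⟩ := hle.exists_isInitialExp hpz
      obtain ⟨h, hh, hh'⟩ := exists_sum_mul_eq hle hμ hG u p hpF hu
      refine ⟨h, hh, fun w hw => ⟨hle.trans _ _ _ (hh' i w hw) (hps u hu.1), fun hws => ?_⟩⟩
      have := hle.antisymm _ _ (hws ▸ hh' i w hw) (hps u hu.1)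
      exact mem_support_iff.1 hu.1 (this ▸ hp0)
  have hsyz := mem_span_of_sum_mul_eq_zero f hreg (Pi.single i P - Pi.single j Q - h) (by
    simp only [Pi.sub_apply, sub_mul, Finset.sum_sub_distrib, ← hh, Pi.single_apply, ite_mul,
      zero_mul, Finset.sum_ite_eq', Finset.mem_univ, if_true]
    rw [hp]
    ring) i
  rw [Pi.sub_apply, Pi.sub_apply, Pi.single_eq_same, Pi.single_eq_of_ne hij, sub_zero] at hsyz
  refine hG _ hsyz _ ⟨?_, fun w hw => ?_⟩
  · have hnot : coeff (μ j - μ i) (h i) = 0 := by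
      by_contra hne
      exact (hh' _ (mem_support_iff.2 hne)).2 (add_comm _ _)
    rw [mem_support_iff, coeff_sub, hnot, sub_zero, hP, coeff_monomial, if_pos rfl]
    exact hcj
  · rcases Finset.mem_union.1 (support_sub _ _ _ hw) with hw | hw
    · rw [Finset.mem_singleton.1 (support_monomial_subset hw)]
      exact hle.refl _
    · refine hle.le_of_add_le_add (p := μ i) ?_
      rw [add_comm (μ j - μ i)]
      exact (hh' w hw).1

/-- The initial monomials of a regular sequence that is a Gröbner basis are pairwise coprime. -/
lemma disjoint_support_of_groebner (hle : IsMonOrder le) {f : Fin r → MvPolynomial (Fin n) K}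
    (hreg : IsRegSeq f)
    {μ : Fin r → Fin n →₀ ℕ} (hμ : ∀ i, IsInitialExp le (f i) (μ i)) (hμ0 : ∀ i, μ i ≠ 0)
    (hG : ∀ p ∈ Ideal.span (Set.range f), ∀ u, IsInitialExp le p u → ∃ i, μ i ≤ u)
    {i j : Fin r} (hij : i ≠ j) : Disjoint (μ i).support (μ j).support := by
  have hdvd : ∀ k l, k ≠ l → ¬ μ k ≤ μ l := fun k l hkl h => by
    obtain ⟨t, ht⟩ := exists_le_tsub hle hreg hμ hG hkl.symm
    rw [tsub_eq_zero_of_le h] at ht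
    exact hμ0 t (le_antisymm ht zero_le)
  obtain ⟨k, hk⟩ := exists_le_tsub hle hreg hμ hG hij
  have hkj : k = j := by
    by_contra hne
    exact hdvd k j hne (hk.trans tsub_le_self)
  subst hkj
  rw [Finset.disjoint_left]
  intro x hx hx'
  have := hk x
  rw [Finsupp.tsub_apply] at this
  rw [Finsupp.mem_support_iff] at hx hx'
  omega

lemma IsRegSeq.ne_zero {f : Fin r → MvPolynomial (Fin n) K} (hreg : IsRegSeq f)
    {a : Fin r → ℕ} (hpos : ∀ i, 0 < a i) (hdeg : ∀ i, (f i).IsHomogeneous (a i)) (i : Fin r) :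
    f i ≠ 0 := by
  intro h0
  have hle : Ideal.span {p | ∃ j : Fin r, j < i ∧ p = f j} ≤ RingHom.ker constantCoeff := by
    rw [Ideal.span_le]
    rintro _ ⟨j, -, rfl⟩
    exact (hdeg j).coeff_eq_zero (by simpa using (hpos j).ne)
  have := hle (hreg i 1 (by rw [h0, mul_zero]; exact Ideal.zero_mem _))
  simp at this

end Groebner

section CoordinateChange

variable {K : Type*} [Field K] {n r : ℕ}

lemma isInitialExp_X_add_X {i j : Fin n} (hij : i < j) :
    IsInitialExp lexLe (X j + X i : MvPolynomial (Fin n) K) (Finsupp.single i 1) := by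
  classical
  constructor
  · have : Finsupp.single j 1 ≠ Finsupp.single i 1 := fun h =>
      hij.ne' ((Finsupp.single_left_inj one_ne_zero).1 h)
    rw [mem_support_iff, coeff_add, coeff_X, if_neg this, coeff_X, if_pos rfl, zero_add]
    exact one_ne_zero
  · intro m hm
    rcases Finset.mem_union.1 (support_add hm) with hm | hm
    · rw [support_X, Finset.mem_singleton] at hm
      subst hm
      refine Or.inr ⟨i, fun l hl => ?_, ?_⟩
      · rw [Finsupp.single_eq_of_ne (hl.trans hij).ne, Finsupp.single_eq_of_ne hl.ne]
      · rw [Finsupp.single_eq_of_ne hij.ne, Finsupp.single_eq_same]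
        exact one_pos
    · rw [support_X, Finset.mem_singleton] at hm
      exact Or.inl hm

lemma exists_perm_apply_eq {ι : Type*} {b c : ι → Fin n} (hb : b.Injective)
    (hc : c.Injective) : ∃ σ : Equiv.Perm (Fin n), ∀ i, σ (b i) = c i := by
  classical
  let e : {x // x ∈ Set.range b} ≃ {x // x ∈ Set.range c} :=
    (Equiv.ofInjective b hb).symm.trans (Equiv.ofInjective c hc)
  refine ⟨e.extendSubtype, fun i => ?_⟩
  rw [Equiv.extendSubtype_apply_of_mem e (b i) ⟨i, rfl⟩]
  have : (Equiv.ofInjective b hb).symm ⟨b i, i, rfl⟩ = i :=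
    Equiv.ofInjective_symm_apply hb i
  simp only [e, Equiv.trans_apply, this, Equiv.ofInjective_apply]

/-- A linear change of coordinates that makes all the variables in the `i`-th set of a family of
disjoint nonempty sets of variables acquire the lexicographic initial monomial `x_i`. -/
lemma exists_linear_change (hrn : r ≤ n) (s : Fin r → Finset (Fin n)) (hs : ∀ i, (s i).Nonempty)
    (hdisj : ∀ i j, i ≠ j → Disjoint (s i) (s j)) :
    ∃ e : MvPolynomial (Fin n) K ≃ₐ[K] MvPolynomial (Fin n) K,
      (∀ j, (e (X j)).IsHomogeneous 1) ∧ (∀ j, (e.symm (X j)).IsHomogeneous 1) ∧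
      ∀ i, ∀ j ∈ s i, IsInitialExp lexLe (e (X j)) (Finsupp.single (Fin.castLE hrn i) 1) := by
  classical
  choose b hb using hs
  have hmem : ∀ {i k j}, j ∈ s i → j ∈ s k → k = i := fun {i k j} hi hk => by
    by_contra hne
    exact Finset.disjoint_left.1 (hdisj k i hne) hk hi
  have hbinj : b.Injective := fun i k h => hmem (hb k) (h ▸ hb i)
  obtain ⟨σ, hσ⟩ := exists_perm_apply_eq hbinj (Fin.castLE_injective hrn)
  let F : Fin n → MvPolynomial (Fin n) K := fun j =>
    X (σ j) + ∑ i, if j ∈ s i ∧ j ≠ b i then X (Fin.castLE hrn i) else 0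
  let G : Fin n → MvPolynomial (Fin n) K := fun l =>
    X (σ.symm l) - ∑ i, if σ.symm l ∈ s i ∧ σ.symm l ≠ b i then X (b i) else 0
  have hFb : ∀ i, F (b i) = X (Fin.castLE hrn i) := fun i => by
    have : ∀ k, ¬(b i ∈ s k ∧ b i ≠ b k) := fun k ⟨h, h'⟩ => h' (by rw [hmem (hb i) h])
    simp only [F, hσ, this, if_false, Finset.sum_const_zero, add_zero]
  have hGb : ∀ i, G (Fin.castLE hrn i) = X (b i) := fun i => by
    have : ∀ k, ¬(b i ∈ s k ∧ b i ≠ b k) := fun k ⟨h, h'⟩ => h' (by rw [hmem (hb i) h])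
    have hi : σ.symm (Fin.castLE hrn i) = b i := by rw [← hσ, σ.symm_apply_apply]
    simp only [G, hi, this, if_false, Finset.sum_const_zero, sub_zero]
  have hFG : (aeval F).comp (aeval G) = AlgHom.id K _ := by
    refine algHom_ext fun l => ?_
    simp only [AlgHom.comp_apply, aeval_X, AlgHom.id_apply]
    simp only [G, map_sub, map_sum, aeval_X, apply_ite (aeval F), map_zero, hFb]
    simp [F]
  have hGF : (aeval G).comp (aeval F) = AlgHom.id K _ := by
    refine algHom_ext fun l => ?_
    simp only [AlgHom.comp_apply, aeval_X, AlgHom.id_apply]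
    simp only [F, map_add, map_sum, aeval_X, apply_ite (aeval G), map_zero, hGb]
    simp [G]
  refine ⟨AlgEquiv.ofAlgHom _ _ hFG hGF, fun j => ?_, fun j => ?_, fun i j hj => ?_⟩
  · rw [AlgEquiv.ofAlgHom_apply, aeval_X]
    refine (isHomogeneous_X _ _).add (IsHomogeneous.sum _ _ _ fun i _ => ?_)
    split_ifs
    exacts [isHomogeneous_X _ _, isHomogeneous_zero _ _ _]
  · rw [AlgEquiv.ofAlgHom_symm_apply, aeval_X]
    refine (isHomogeneous_X _ _).sub (IsHomogeneous.sum _ _ _ fun i _ => ?_)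
    split_ifs
    exacts [isHomogeneous_X _ _, isHomogeneous_zero _ _ _]
  · rw [AlgEquiv.ofAlgHom_apply, aeval_X]
    by_cases hjb : j = b i
    · rw [hjb, hFb]
      exact isInitialExp_monomial isMonOrder_lexLe _ one_ne_zero
    · have hsum : (∑ k, if j ∈ s k ∧ j ≠ b k then
          (X (Fin.castLE hrn k) : MvPolynomial (Fin n) K) else 0) = X (Fin.castLE hrn i) := by
        rw [Finset.sum_eq_single i (fun k _ hk => if_neg fun h => hk (hmem hj h.1))
          (fun h => absurd (Finset.mem_univ i) h), if_pos ⟨hj, hjb⟩]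
      simp only [F, hsum]
      refine isInitialExp_X_add_X (not_le.1 fun hle => ?_)
      have hlt : (σ j : ℕ) < r := (show (σ j : ℕ) ≤ i from hle).trans_lt i.2
      obtain ⟨t, ht⟩ : ∃ t, b t = j := ⟨⟨σ j, hlt⟩, σ.injective ((hσ _).trans rfl)⟩
      exact hjb (ht.symm.trans (congrArg b (hmem hj (ht ▸ hb t))))

lemma isHomogeneous_map_of_X {e : MvPolynomial (Fin n) K →ₐ[K] MvPolynomial (Fin n) K}
    (he : ∀ j, (e (X j)).IsHomogeneous 1) {p : MvPolynomial (Fin n) K} {d : ℕ}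
    (hp : p.IsHomogeneous d) : (e p).IsHomogeneous d := by
  rw [aeval_unique e]
  exact one_mul d ▸ hp.aeval _ he

lemma hilb_comap_symm (e : MvPolynomial (Fin n) K ≃ₐ[K] MvPolynomial (Fin n) K)
    (he : ∀ j, (e (X j)).IsHomogeneous 1) (he' : ∀ j, (e.symm (X j)).IsHomogeneous 1)
    (I : Ideal (MvPolynomial (Fin n) K)) (d : ℕ) : hilb (I.comap e.symm) d = hilb I d := by
  have : component (I.comap e.symm) d = (component I d).map (e.toLinearEquiv : _ →ₗ[K] _) := by
    ext p
    constructor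
    · rintro ⟨hp, hd⟩
      exact ⟨e.symm p, ⟨hp, isHomogeneous_map_of_X (e := e.symm.toAlgHom) he' hd⟩,
        e.apply_symm_apply p⟩
    · rintro ⟨q, ⟨hq, hd⟩, rfl⟩
      refine ⟨?_, isHomogeneous_map_of_X (e := e.toAlgHom) he hd⟩
      change e.symm (e q) ∈ I
      rwa [e.symm_apply_apply]
  rw [hilb, this, LinearEquiv.finrank_map_eq, hilb]

/-- If the initial ideal of `I` contains pairwise coprime monomials of degrees `a`, then the Hilbert
function of `I` counts an upper set of exponents that contains the pure-powers ideal. -/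
lemma exists_isUpperSet_hilb_eq {le : (Fin n →₀ ℕ) → (Fin n →₀ ℕ) → Prop} (hle : IsMonOrder le)
    (hrn : r ≤ n) {a : Fin r → ℕ} {I : Ideal (MvPolynomial (Fin n) K)} {μ : Fin r → Fin n →₀ ℕ}
    (hμI : ∀ i, μ i ∈ initialExps le I) (hμ0 : ∀ i, μ i ≠ 0) (hμa : ∀ i, expDeg (μ i) = a i)
    (hdisj : ∀ i j, i ≠ j → Disjoint (μ i).support (μ j).support) :
    ∃ U : Set (Fin n →₀ ℕ), IsUpperSet U ∧ powerExps hrn a ⊆ U ∧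
      ∀ d, hilb I d = {m ∈ U | expDeg m = d}.ncard := by
  obtain ⟨e, he, he', hlead⟩ := exists_linear_change (K := K) hrn (fun i => (μ i).support)
    (fun i => Finsupp.support_nonempty_iff.2 (hμ0 i)) hdisj
  have hU := isUpperSet_initialExps hle I
  set M := Ideal.span ((fun m => (monomial m (1 : K) : MvPolynomial (Fin n) K)) ''
    initialExps le I)
  have hU' := isUpperSet_initialExps isMonOrder_lexLe (M.comap e.symm)
  refine ⟨initialExps lexLe (M.comap e.symm), hU', ?_, fun d => ?_⟩
  · rintro m ⟨i, hi⟩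
    refine hU' (Finsupp.single_le_iff.2 hi) ?_
    have hinit : IsInitialExp lexLe (e (monomial (μ i) 1))
        (Finsupp.single (Fin.castLE hrn i) (a i)) := by
      have h1 : e (monomial (μ i) (1 : K)) = ∏ j ∈ (μ i).support, e (X j) ^ μ i j := by
        rw [monomial_eq, C_1, one_mul, Finsupp.prod, map_prod]
        simp only [map_pow]
      have h2 : Finsupp.single (Fin.castLE hrn i) (a i) =
          ∑ j ∈ (μ i).support, μ i j • Finsupp.single (Fin.castLE hrn i) 1 := by
        simp only [Finsupp.smul_single, smul_eq_mul, mul_one]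
        rw [← Finsupp.single_finsetSum, ← hμa i, expDeg]
        congr 1
        exact (Finset.sum_subset (Finset.subset_univ _) (by simp)).symm
      rw [h1, h2]
      exact IsInitialExp.prod isMonOrder_lexLe _ fun j hj =>
        (hlead i j hj).pow isMonOrder_lexLe _
    refine ⟨_, ⟨?_, ?_⟩, hinit⟩
    · change e.symm (e _) ∈ M
      rw [e.symm_apply_apply]
      exact Ideal.subset_span ⟨_, hμI i, rfl⟩
    · refine isHomogeneous_map_of_X (e := e.toAlgHom) he ?_
      refine mem_homogeneousSubmodule_iff.2 fun u hu => ?_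
      rw [Finset.mem_singleton.1 (support_monomial_subset hu), hμa, expDeg_single]
  · rw [← hilb_eq_ncard_initialExps isMonOrder_lexLe, hilb_comap_symm e he he',
      hilb_eq_ncard_initialExps hle M, initialExps_span_monomial hle hU,
      hilb_eq_ncard_initialExps hle I]

end CoordinateChange

/-- If `f_1,…,f_r` is a homogeneous regular sequence of degree `a` which is a Gröbner basis
with respect to some monomial order (i.e. the initial ideal of `(f_1,…,f_r)` is generated
by the initial monomials of the `f_i`), then every homogeneous ideal containing
`(f_1,…,f_r)` satisfies `EGH_a`. -/
theorem egh_of_groebner_regular_sequence {K : Type*} [Field K] {n r : ℕ} (hrn : r ≤ n)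
    (a : Fin r → ℕ) (hpos : ∀ i, 0 < a i) (hmono : Monotone a)
    (f : Fin r → MvPolynomial (Fin n) K)
    (hreg : IsRegSeq f) (hdeg : ∀ i, (f i).IsHomogeneous (a i))
    (le : (Fin n →₀ ℕ) → (Fin n →₀ ℕ) → Prop)
    (htot : ∀ m m', le m m' ∨ le m' m)
    (hanti : ∀ m m', le m m' → le m' m → m = m')
    (htrans : ∀ m₁ m₂ m₃, le m₁ m₂ → le m₂ m₃ → le m₁ m₃)
    (hadd : ∀ m m' p, le m m' → le (m + p) (m' + p))
    (hzero : ∀ m, le 0 m)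
    (hGB : initialIdeal le (Ideal.span (Set.range f)) =
      Ideal.span { q | ∃ (i : Fin r) (mm : Fin n →₀ ℕ), IsInitialExp le (f i) mm ∧
        q = (monomial mm (1 : K) : MvPolynomial (Fin n) K) }) :
    ∀ I : Ideal (MvPolynomial (Fin n) K), IsHomog I →
      Ideal.span (Set.range f) ≤ I → EGH hrn a I := by
  have hle : IsMonOrder le := ⟨htot, hanti, htrans, hadd, hzero⟩
  intro I _ hfI
  choose μ hμ using fun i => hle.exists_isInitialExp (hreg.ne_zero hpos hdeg i)
  have hμa : ∀ i, expDeg (μ i) = a i := fun i =>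
    mem_homogeneousSubmodule_iff.1 ((mem_homogeneousSubmodule _ _).2 (hdeg i)) _ (hμ i).1
  have hμ0 : ∀ i, μ i ≠ 0 := fun i h => by
    have h' := hμa i
    rw [h] at h'
    exact (hpos i).ne (by simpa [expDeg] using h')
  have hμI : ∀ i, μ i ∈ initialExps le I := fun i =>
    ⟨f i, ⟨hfI (Ideal.subset_span ⟨i, rfl⟩), (hμa i).symm ▸ hdeg i⟩, hμ i⟩
  have hdisj : ∀ i j, i ≠ j → Disjoint (μ i).support (μ j).support := fun i j hij =>
    disjoint_support_of_groebner hle hreg hμ hμ0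
      (fun p hp u hu => exists_le_of_initialIdeal_eq hle hμ hGB hp hu) hij
  obtain ⟨U, hU, hPU, hI⟩ := exists_isUpperSet_hilb_eq hle hrn hμI hμ0 hμa hdisj
  exact egh_of_hilb_eq_ncard hmono hU hPU hI
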